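/- arXiv:1210.2679 — 3 statements merged into one kernel-verified Lean document; each statement's English description precedes it below -/
import Mathlib

section
/- Fix a prime p and w ≥ 0. The matrix M = M(h, p̃; w), whose (λ,μ)-entry is the number of maps f: {1,…,l(μ)} → {1,…,l(λ)} such that Σ_{j ∈ f^{-1}(i)} μ_j = λ_i for all i, splits over ℤ_(p) with respect to the set partition Par(w) = ⊔_{ν ∈ Par'(w)} Par(w, ν). -/
open scoped BigOperators
open Classical

noncomputable section

/-- The number of maps `f` from the (indexed) parts of `mu` to the parts of `lam` such that for
every part `lam_i` of `lam`, the sum of the parts of `mu` in the fibre `f⁻¹(i)` equals `lam_i`.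
This is `|𝓜_{λμ}|` and also the value of the permutation character `h_λ` on the class of cycle
type `μ`. -/
def Mcount (lam mu : Multiset ℕ) : ℕ :=
  Fintype.card {f : Fin (Multiset.card mu) → Fin (Multiset.card lam) //
    ∀ i : Fin (Multiset.card lam),
      (∑ j ∈ Finset.univ.filter (fun j => f j = i), (mu.sort (· ≤ ·)).getD j 0)
        = (lam.sort (· ≤ ·)).getD i 0}

/-- `z_λ = ∏_i i^{m_i(λ)} m_i(λ)!`. -/
def zMult (lam : Multiset ℕ) : ℕ :=
  ∏ i ∈ lam.toFinset, i ^ lam.count i * (lam.count i).factorial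

/-- The cycle type of a permutation of `Fin n`, as the multiset of parts of a partition of `n`
(including the parts equal to `1` corresponding to fixed points). -/
def cycM {n : ℕ} (g : Equiv.Perm (Fin n)) : Multiset ℕ :=
  g.cycleType + Multiset.replicate (n - g.support.card) 1

/-- The value of the irreducible character `s_λ` of the symmetric group on the conjugacy class
of cycle type `nu`, given by the Jacobi–Trudi determinant `s_λ = det(h_{λ_i - i + j})_{i,j}`,
where `h_α` has value `Mcount α ν` on the class of cycle type `ν`. -/
def sval (lam nu : Multiset ℕ) : ℚ :=
  let L := (lam.sort (· ≤ ·)).reverse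
  let l := Multiset.card lam
  ∑ σ : Equiv.Perm (Fin l),
    ((Equiv.Perm.sign σ : ℤ) : ℚ) *
      (if ∀ i : Fin l, (i : ℕ) ≤ L.getD i 0 + (σ i : ℕ) then
        (Mcount ((Multiset.map (fun i : Fin l => L.getD i 0 + (σ i : ℕ) - (i : ℕ))
            (Finset.univ.val : Multiset (Fin l))).filter (fun x => x ≠ 0)) nu : ℚ)
       else 0)

/-- The irreducible character of `S_n` labelled by the partition `lam`, as a class function on
the symmetric group `S_n = Perm (Fin n)`. -/
def sFun {n : ℕ} (lam : Nat.Partition n) : Equiv.Perm (Fin n) → ℚ :=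
  fun g => sval lam.parts (cycM g)

/-- The usual scalar product of class functions on a finite group:
`⟨f, h⟩ = |G|⁻¹ ∑_{g ∈ G} f(g) h(g⁻¹)`. -/
def sp {G : Type*} [Group G] [Fintype G] (f h : G → ℚ) : ℚ :=
  (Fintype.card G : ℚ)⁻¹ * ∑ g : G, f g * h g⁻¹

/-- The subring `ℤ_(p) = {a/b ∈ ℚ : p ∤ b} ⊆ ℚ`. -/
def Zploc (p : ℕ) (hp : p.Prime) : Subring ℚ where
  carrier := {x : ℚ | ∃ a b : ℤ, ¬ (p : ℤ) ∣ b ∧ x = a / b}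
  zero_mem' :=
    ⟨0, 1, fun h => by have h1 := Int.le_of_dvd one_pos h; have h2 := hp.two_le; omega, by simp⟩
  one_mem' :=
    ⟨1, 1, fun h => by have h1 := Int.le_of_dvd one_pos h; have h2 := hp.two_le; omega, by simp⟩
  add_mem' := by
    rintro x y ⟨a, b, hb, rfl⟩ ⟨c, d, hd, rfl⟩
    have hb0 : (b : ℚ) ≠ 0 := by
      intro h
      apply hb
      have hb' : b = 0 := by exact_mod_cast h
      simp [hb']
    have hd0 : (d : ℚ) ≠ 0 := by
      intro h
      apply hd
      have hd' : d = 0 := by exact_mod_cast h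
      simp [hd']
    refine ⟨a * d + c * b, b * d, ?_, ?_⟩
    · intro h
      rcases (Nat.prime_iff_prime_int.mp hp).dvd_mul.mp h with h' | h'
      · exact hb h'
      · exact hd h'
    · push_cast
      field_simp
  neg_mem' := by
    rintro x ⟨a, b, hb, rfl⟩
    exact ⟨-a, b, hb, by push_cast; ring⟩
  mul_mem' := by
    rintro x y ⟨a, b, hb, rfl⟩ ⟨c, d, hd, rfl⟩
    refine ⟨a * c, b * d, ?_, ?_⟩
    · intro h
      rcases (Nat.prime_iff_prime_int.mp hp).dvd_mul.mp h with h' | h'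
      · exact hb h'
      · exact hd h'
    · push_cast
      ring

/-- The matrix `M = M(h, p̃; w)`: `M_{λμ} = |𝓜_{λμ}|` is the number of maps
`f : [1, l(μ)] → [1, l(λ)]` with `∑_{j ∈ f⁻¹(i)} μ_j = λ_i` for all `i`. -/
def Mmat (w : ℕ) : Matrix (Nat.Partition w) (Nat.Partition w) ℚ :=
  Matrix.of fun lam mu => (Mcount lam.parts mu.parts : ℚ)

/-- `∑_{n ≥ 0} m_{j p^n}(λ) p^n`. -/
def wsum (p j : ℕ) (lam : Multiset ℕ) : ℕ := ∑ᶠ n : ℕ, lam.count (j * p ^ n) * p ^ n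

/-- `λ` and `μ` lie in the same block `Par(w, ν)` of the set partition
`Par(w) = ⊔_{ν ∈ Par'(w)} Par(w, ν)`: for every `j` prime to `p`,
`∑_n m_{j p^n}(λ) p^n = ∑_n m_{j p^n}(μ) p^n` `(= m_j(ν))`. -/
def samePBlock (p : ℕ) (lam mu : Multiset ℕ) : Prop :=
  ∀ j : ℕ, ¬ p ∣ j → wsum p j lam = wsum p j mu

/-! ### Auxiliary counting function -/

/-- number of maps with prescribed fibre sums -/
def NN {ι κ : Type} [DecidableEq ι] [Fintype κ] (α : ι → ℕ) (m : κ → ℕ) : ℕ :=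
  Nat.card {f : κ → ι // ∀ i, (∑ j ∈ Finset.univ.filter (fun j => f j = i), m j) = α i}

/-- the parts of a partition as a function -/
def mm {w : ℕ} (mu : Nat.Partition w) : Fin (Multiset.card mu.parts) → ℕ :=
  fun j => (mu.parts.sort (· ≤ ·)).getD j 0

lemma map_mm {w : ℕ} (mu : Nat.Partition w) :
    (Finset.univ.val : Multiset (Fin (Multiset.card mu.parts))).map (mm mu) = mu.parts := by
  rw [Fin.univ_val_map]
  conv_rhs => rw [← Multiset.sort_eq mu.parts (· ≤ ·)]
  congr 1
  apply List.ext_getElem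
  · simp
  · intro i h1 h2
    simp only [List.getElem_ofFn, mm]
    exact List.getD_eq_getElem _ _ h2

lemma sum_mm {w : ℕ} (mu : Nat.Partition w) : ∑ j, mm mu j = w := by
  have := congrArg Multiset.sum (map_mm mu)
  rw [mu.parts_sum] at this
  exact this

lemma pos_mm {w : ℕ} (mu : Nat.Partition w) (j) : 0 < mm mu j := by
  apply mu.parts_pos
  have : mm mu j ∈ (Finset.univ.val : Multiset (Fin (Multiset.card mu.parts))).map (mm mu) :=
    Multiset.mem_map_of_mem _ (Finset.mem_univ j)
  rwa [map_mm] at this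

lemma Mcount_eq_NN {w : ℕ} (lam mu : Nat.Partition w) :
    Mcount lam.parts mu.parts = NN (mm lam) (mm mu) := by
  unfold Mcount NN mm
  exact (Nat.card_eq_fintype_card).symm

lemma exists_equiv_of_map_eq {ι ι' : Type} [Fintype ι] [Fintype ι'] (f : ι → ℕ) (g : ι' → ℕ)
    (h : (Finset.univ.val : Multiset ι).map f = (Finset.univ.val : Multiset ι').map g) :
    ∃ e : ι ≃ ι', ∀ i, g (e i) = f i := by
  have hc : ∀ c, Nonempty ({x // f x = c} ≃ {x // g x = c}) := by
    intro c
    refine ⟨Fintype.equivOfCardEq ?_⟩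
    have := congrArg (Multiset.count c) h
    rw [Multiset.count_map, Multiset.count_map] at this
    rw [Fintype.card_subtype, Fintype.card_subtype]
    simp only [Finset.card, Finset.filter_val]
    simpa only [eq_comm] using this
  have e := fun c => Classical.choice (hc c)
  refine ⟨((Equiv.sigmaFiberEquiv f).symm.trans (Equiv.sigmaCongrRight e)).trans
    (Equiv.sigmaFiberEquiv g), ?_⟩
  intro i
  exact (e (f i) ⟨i, rfl⟩).2

lemma NN_emb {ι ι' κ : Type} [Fintype ι] [Fintype ι'] [Fintype κ]
    [DecidableEq ι] [DecidableEq ι'] (α : ι → ℕ) (α' : ι' → ℕ)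
    (m : κ → ℕ) (hm : ∀ j, 0 < m j) (e : ι' → ι) (he : Function.Injective e)
    (h1 : ∀ i, α (e i) = α' i) (h2 : ∀ i, i ∉ Set.range e → α i = 0) :
    NN α' m = NN α m := by
  unfold NN
  refine Nat.card_eq_of_bijective (fun f => ⟨fun j => e (f.1 j), ?_⟩) ⟨?_, ?_⟩
  · intro i
    by_cases hi : i ∈ Set.range e
    · obtain ⟨i', rfl⟩ := hi
      rw [h1, ← f.2 i']
      simp only [he.eq_iff]
    · rw [h2 i hi]
      apply Finset.sum_eq_zero
      intro j hj
      exact absurd ⟨f.1 j, (Finset.mem_filter.1 hj).2⟩ hi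
  · intro f g hfg
    ext j
    have := congrFun (congrArg Subtype.val hfg) j
    exact he this
  · rintro ⟨f, hf⟩
    have : ∀ j, ∃ i', e i' = f j := by
      intro j
      by_contra hcon
      have h0 := h2 (f j) hcon
      rw [← hf (f j)] at h0
      have := (Finset.sum_eq_zero_iff.1 h0) j (by simp)
      have := hm j
      omega
    choose g hg using this
    refine ⟨⟨g, ?_⟩, ?_⟩
    · intro i
      rw [← h1, ← hf]
      simp only [← hg, he.eq_iff]
    · ext j
      exact hg j

lemma sum_fib {ι κ : Type} [Fintype ι] [Fintype κ] [DecidableEq ι] (f : κ → ι) (m : κ → ℕ) :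
    ∑ i, ∑ j ∈ Finset.univ.filter (fun j => f j = i), m j = ∑ j, m j :=
  Finset.sum_fiberwise _ _ _

/-- the row space -/
def VV (p : ℕ) (hp : p.Prime) (w : ℕ) : Submodule (Zploc p hp) (Nat.Partition w → ℚ) :=
  Submodule.span (Zploc p hp) (Set.range (fun lam : Nat.Partition w => Mmat w lam))

lemma NN_mem (p : ℕ) (hp : p.Prime) (w : ℕ) {ι : Type} [Fintype ι] [DecidableEq ι] (α : ι → ℕ) :
    (fun mu : Nat.Partition w => (NN α (mm mu) : ℚ)) ∈ VV p hp w := by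
  by_cases hα : ∑ i, α i = w
  · let lam : Nat.Partition w := Nat.Partition.ofSums w ((Finset.univ.val : Multiset ι).map α) hα
    have hlam : lam.parts = ((Finset.univ.val : Multiset ι).map α).filter (· ≠ 0) := rfl
    have hmap : (Finset.univ.val : Multiset (Fin (Multiset.card lam.parts))).map (mm lam) =
        (Finset.univ.val : Multiset {i // α i ≠ 0}).map (fun i => α i.1) := by
      rw [map_mm, hlam, Multiset.filter_map]
      have : (Finset.univ.val : Multiset {i // α i ≠ 0}).map Subtype.val =
        Multiset.filter ((fun x => x ≠ 0) ∘ α) (Finset.univ.val : Multiset ι) := by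
        have := congrArg Finset.val (Finset.subtype_map (s := Finset.univ) (fun i => α i ≠ 0))
        simpa [Function.comp_def] using this
      rw [← this, Multiset.map_map]
      rfl
    obtain ⟨e, he⟩ := exists_equiv_of_map_eq _ _ hmap
    have : (fun mu : Nat.Partition w => (NN α (mm mu) : ℚ)) = Mmat w lam := by
      ext mu
      change _ = (Mcount lam.parts mu.parts : ℚ)
      rw [Mcount_eq_NN, NN_emb α (mm lam) (mm mu) (pos_mm mu) (fun i => (e i).1)
        (Subtype.val_injective.comp e.injective) he]
      intro i hi
      by_contra h0
      exact hi ⟨e.symm ⟨i, h0⟩, by simp⟩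
    rw [this]
    exact Submodule.subset_span ⟨lam, rfl⟩
  · have : (fun mu : Nat.Partition w => (NN α (mm mu) : ℚ)) = 0 := by
      ext mu
      simp only [Pi.zero_apply, Nat.cast_eq_zero]
      unfold NN
      rw [Nat.card_eq_zero]
      refine Or.inl ⟨fun f => hα ?_⟩
      rw [← sum_mm mu, ← sum_fib f.1 (mm mu)]
      exact Finset.sum_congr rfl fun i _ => (f.2 i).symm
    rw [this]
    exact zero_mem _

lemma one_mem_VV (p : ℕ) (hp : p.Prime) (w : ℕ) : (1 : Nat.Partition w → ℚ) ∈ VV p hp w := by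
  convert NN_mem p hp w (fun _ : Unit => w) using 1
  ext mu
  unfold NN
  simp only [Pi.one_apply]
  symm
  rw [Nat.cast_eq_one, Nat.card_eq_fintype_card, Fintype.card_eq_one_iff]
  refine ⟨⟨fun _ => (), fun i => by simp [sum_mm]⟩, fun y => Subsingleton.elim _ _⟩

lemma NN_mul {ι ι' κ : Type} [Fintype ι] [Fintype ι'] [Fintype κ]
    [DecidableEq ι] [DecidableEq ι'] (α : ι → ℕ) (β : ι' → ℕ)
    (m : κ → ℕ) (w : ℕ) (hw : ∑ j, m j = w) :
    NN α m * NN β m = ∑ A ∈ (Fintype.piFinset (fun _ : ι × ι' => Finset.range (w + 1))).filter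
      (fun A => (∀ i, ∑ k, A (i, k) = α i) ∧ (∀ k, ∑ i, A (i, k) = β k)), NN A m := by
  have key1 : ∀ (h : κ → ι × ι') (i : ι),
      ∑ k, ∑ j ∈ Finset.univ.filter (fun j => h j = (i, k)), m j =
        ∑ j ∈ Finset.univ.filter (fun j => (h j).1 = i), m j := by
    intro h i
    rw [← Finset.sum_fiberwise _ (fun j => (h j).2) m]
    refine Finset.sum_congr rfl fun k _ => Finset.sum_congr ?_ fun _ _ => rfl
    ext j
    simp [Prod.ext_iff]
  have key2 : ∀ (h : κ → ι × ι') (k : ι'),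
      ∑ i, ∑ j ∈ Finset.univ.filter (fun j => h j = (i, k)), m j =
        ∑ j ∈ Finset.univ.filter (fun j => (h j).2 = k), m j := by
    intro h k
    rw [← Finset.sum_fiberwise _ (fun j => (h j).1) m]
    refine Finset.sum_congr rfl fun i _ => Finset.sum_congr ?_ fun _ _ => rfl
    ext j
    simp [Prod.ext_iff, and_comm]
  let S : Finset (κ → ι × ι') := Finset.univ.filter fun h =>
    (∀ i, ∑ j ∈ Finset.univ.filter (fun j => (h j).1 = i), m j = α i) ∧
    (∀ k, ∑ j ∈ Finset.univ.filter (fun j => (h j).2 = k), m j = β k)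
  have hS : NN α m * NN β m = S.card := by
    unfold NN
    rw [← Nat.card_prod, ← Fintype.card_coe, ← Nat.card_eq_fintype_card]
    refine Nat.card_congr ⟨fun x => ⟨fun j => (x.1.1 j, x.2.1 j), ?_⟩,
      fun h => (⟨fun j => (h.1 j).1, ?_⟩, ⟨fun j => (h.1 j).2, ?_⟩), ?_, ?_⟩
    · exact Finset.mem_filter.2 ⟨Finset.mem_univ _, x.1.2, x.2.2⟩
    · exact (Finset.mem_filter.1 h.2).2.1
    · exact (Finset.mem_filter.1 h.2).2.2
    · intro x; rfl
    · intro x; rfl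
  rw [hS, Finset.card_eq_sum_card_fiberwise
    (f := fun h => fun i => ∑ j ∈ Finset.univ.filter (fun j => h j = i), m j)
    (t := (Fintype.piFinset (fun _ : ι × ι' => Finset.range (w + 1))).filter
      (fun A => (∀ i, ∑ k, A (i, k) = α i) ∧ (∀ k, ∑ i, A (i, k) = β k)))]
  · refine Finset.sum_congr rfl fun A hA => ?_
    have hA' := (Finset.mem_filter.1 hA).2
    unfold NN
    rw [Nat.card_eq_fintype_card, Fintype.card_subtype]
    congr 1
    ext h
    simp only [S, Finset.mem_filter, Finset.mem_univ, true_and, funext_iff]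
    constructor
    · exact fun hh => hh.2
    · intro hh
      refine ⟨⟨fun i => ?_, fun k => ?_⟩, hh⟩
      · rw [← key1, ← hA'.1 i]
        exact Finset.sum_congr rfl fun k _ => hh _
      · rw [← key2, ← hA'.2 k]
        exact Finset.sum_congr rfl fun k _ => hh _
  · intro h hh
    have hh' := (Finset.mem_filter.1 hh).2
    refine Finset.mem_coe.2 (Finset.mem_filter.2 ⟨?_, ?_, ?_⟩)
    · rw [Fintype.mem_piFinset]
      intro i
      rw [Finset.mem_range, Nat.lt_succ_iff, ← hw]
      exact Finset.sum_le_sum_of_subset (Finset.filter_subset _ _)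
    · intro i
      rw [key1, hh'.1]
    · intro k
      rw [key2, hh'.2]

lemma mul_mem_VV (p : ℕ) (hp : p.Prime) (w : ℕ) (x y : Nat.Partition w → ℚ)
    (hx : x ∈ VV p hp w) (hy : y ∈ VV p hp w) : x * y ∈ VV p hp w := by
  have h := Submodule.mul_mem_mul hx hy
  unfold VV at h
  rw [Submodule.span_mul_span] at h
  refine (Submodule.span_le.2 ?_) h
  rintro _ ⟨_, ⟨l1, rfl⟩, _, ⟨l2, rfl⟩, rfl⟩
  have : (fun x1 x2 => x1 * x2) ((fun lam : Nat.Partition w => Mmat w lam) l1)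
      ((fun lam : Nat.Partition w => Mmat w lam) l2) =
      ∑ A ∈ (Fintype.piFinset (fun _ : Fin (Multiset.card l1.parts) × Fin (Multiset.card l2.parts)
          => Finset.range (w + 1))).filter
      (fun A => (∀ i, ∑ k, A (i, k) = mm l1 i) ∧ (∀ k, ∑ i, A (i, k) = mm l2 k)),
        (fun mu : Nat.Partition w => (NN A (mm mu) : ℚ)) := by
    ext mu
    rw [Finset.sum_apply]
    change (Mcount l1.parts mu.parts : ℚ) * (Mcount l2.parts mu.parts : ℚ) = _
    rw [Mcount_eq_NN, Mcount_eq_NN, ← Nat.cast_mul, NN_mul _ _ _ w (sum_mm mu), Nat.cast_sum]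
    refine Finset.sum_congr ?_ fun _ _ => rfl
    congr
  rw [SetLike.mem_coe]
  refine (congrArg (· ∈ VV p hp w) this).mpr ?_
  exact Submodule.sum_mem _ fun A _ => NN_mem p hp w A

/-- the row space as a subalgebra -/
def VA (p : ℕ) (hp : p.Prime) (w : ℕ) : Subalgebra (Zploc p hp) (Nat.Partition w → ℚ) :=
  (VV p hp w).toSubalgebra (one_mem_VV p hp w) (mul_mem_VV p hp w)

/-! ### The two-row characters -/

open Polynomial in
/-- generating polynomial of two-row permutation characters -/
def PP (s : Multiset ℕ) : ℤ[X] := (s.map fun i => 1 + X ^ i).prod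

open Polynomial in
lemma PP_coeff_mem (p : ℕ) (hp : p.Prime) (w k : ℕ) :
    (fun mu : Nat.Partition w => ((PP mu.parts).coeff k : ℚ)) ∈ VA p hp w := by
  change _ ∈ VV p hp w
  convert NN_mem p hp w (fun b : Bool => if b then k else w - k) using 1
  ext mu
  have h1 : PP mu.parts = ∏ j, ∑ b : Bool, (X : ℤ[X]) ^ (if b then mm mu j else 0) := by
    unfold PP
    conv_lhs => rw [← map_mm mu]
    rw [Multiset.map_map]
    refine Finset.prod_congr rfl fun j _ => ?_
    simp [add_comm]
  rw [h1, Finset.prod_univ_sum]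
  simp only [Finset.prod_pow_eq_pow_sum, Fintype.piFinset_univ, finsetSum_coeff, coeff_X_pow]
  rw [Finset.sum_boole]
  unfold NN
  rw [Nat.card_eq_fintype_card, Fintype.card_subtype]
  push_cast
  congr 2
  ext f
  have hs := sum_fib f (mm mu)
  rw [sum_mm] at hs
  simp only [Fintype.sum_bool] at hs
  simp only [Finset.mem_filter, Finset.mem_univ, true_and, Bool.forall_bool, ← Finset.sum_filter]
  simp only [if_true, Bool.false_eq_true, if_false]
  omega

/-! ### Blocks and the two-row characters modulo a prime -/

lemma wsum_zero (p j : ℕ) : wsum p j 0 = 0 := by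
  unfold wsum
  simp

lemma pow_inj_aux {p : ℕ} (hp : p.Prime) {j j' n n' : ℕ} (hj : ¬ p ∣ j) (hj' : ¬ p ∣ j')
    (h : j * p ^ n = j' * p ^ n') : j = j' ∧ n = n' := by
  have hn : n = n' := by
    rcases lt_trichotomy n n' with h1 | h1 | h1
    · exfalso
      obtain ⟨d, rfl⟩ := Nat.exists_eq_add_of_lt h1
      apply hj
      have : j = j' * p ^ (d + 1) := by
        apply Nat.eq_of_mul_eq_mul_right (pow_pos hp.pos n)
        rw [h]; ring
      rw [this, pow_succ]
      exact Dvd.intro_left _ (by rw [mul_assoc])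
    · exact h1
    · exfalso
      obtain ⟨d, rfl⟩ := Nat.exists_eq_add_of_lt h1
      apply hj'
      have : j' = j * p ^ (d + 1) := by
        apply Nat.eq_of_mul_eq_mul_right (pow_pos hp.pos n')
        rw [← h]; ring
      rw [this, pow_succ]
      exact Dvd.intro_left _ (by rw [mul_assoc])
  subst hn
  exact ⟨Nat.eq_of_mul_eq_mul_right (pow_pos hp.pos n) h, rfl⟩

lemma wsum_supp {p : ℕ} (hp : p.Prime) {j : ℕ} (hj : ¬ p ∣ j) (s : Multiset ℕ) :
    (Function.support fun n : ℕ => s.count (j * p ^ n) * p ^ n).Finite := by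
  apply Set.Finite.subset (s := (fun n => j * p ^ n) ⁻¹' (s.toFinset : Set ℕ))
  · apply Set.Finite.preimage
    · intro a _ b _ h
      exact (pow_inj_aux hp hj hj h).2
    · exact Finset.finite_toSet _
  · intro n hn
    simp only [Function.mem_support, ne_eq, mul_eq_zero, not_or] at hn
    simpa using Multiset.count_ne_zero.1 hn.1

lemma wsum_cons {p : ℕ} (hp : p.Prime) {j j0 n0 : ℕ} (hj : ¬ p ∣ j) (hj0 : ¬ p ∣ j0)
    (s : Multiset ℕ) :
    wsum p j ((j0 * p ^ n0) ::ₘ s) = wsum p j s + if j = j0 then p ^ n0 else 0 := by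
  have h1 : ∀ n, ((j0 * p ^ n0) ::ₘ s).count (j * p ^ n) * p ^ n =
      s.count (j * p ^ n) * p ^ n + if n = n0 then (if j = j0 then p ^ n0 else 0) else 0 := by
    intro n
    rw [Multiset.count_cons, add_mul]
    congr 1
    by_cases h : j * p ^ n = j0 * p ^ n0
    · obtain ⟨rfl, rfl⟩ := pow_inj_aux hp hj hj0 h
      simp
    · rw [if_neg h]
      by_cases hn : n = n0
      · subst hn
        have : j ≠ j0 := fun h' => h (by rw [h'])
        simp [this]
      · simp [hn]
  unfold wsum
  rw [finsum_congr h1, finsum_add_distrib (wsum_supp hp hj s)]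
  · congr 1
    rw [finsum_eq_single _ n0]
    · simp
    · intro n hn; simp [hn]
  · apply Set.Finite.subset (Set.finite_singleton n0)
    intro n hn
    by_contra h
    simp at h
    simp [h] at hn

open Polynomial in
lemma PP_map_eq {p : ℕ} (hp : p.Prime) (J : Finset ℕ) (hJ : ∀ j ∈ J, ¬ p ∣ j) (s : Multiset ℕ)
    (hs : ∀ i ∈ s, 0 < i) (hsJ : ∀ i ∈ s, ∀ j, j ∣ i → ¬ p ∣ j → j ∈ J) :
    (PP s).map (Int.castRingHom (ZMod p)) = ∏ j ∈ J, (1 + X ^ j) ^ wsum p j s := by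
  haveI : Fact p.Prime := ⟨hp⟩
  induction s using Multiset.induction_on with
  | empty => simp [PP, wsum_zero]
  | cons a s ih =>
    have ha : a ≠ 0 := (hs a (by simp)).ne'
    obtain ⟨n0, j0, hj0, haj⟩ := Nat.exists_eq_pow_mul_and_not_dvd ha p hp.ne_one
    have haj' : a = j0 * p ^ n0 := by rw [haj, mul_comm]
    have hj0J : j0 ∈ J := hsJ a (by simp) j0 ⟨_, haj'⟩ hj0
    have ih' := ih (fun i hi => hs i (by simp [hi])) (fun i hi => hsJ i (by simp [hi]))
    have h1 : PP (a ::ₘ s) = (1 + X ^ a) * PP s := by simp [PP]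
    rw [h1, Polynomial.map_mul, ih']
    have h2 : ∏ j ∈ J, (1 + X ^ j : (ZMod p)[X]) ^ wsum p j (a ::ₘ s) =
        (∏ j ∈ J, (1 + X ^ j) ^ wsum p j s) *
          ∏ j ∈ J, (1 + X ^ j) ^ (if j = j0 then p ^ n0 else 0) := by
      rw [← Finset.prod_mul_distrib]
      refine Finset.prod_congr rfl fun j hj => ?_
      rw [← pow_add, haj', wsum_cons hp (hJ j hj) hj0]
    rw [h2, mul_comm]
    congr 1
    rw [Finset.prod_eq_single j0]
    · rw [if_pos rfl, add_pow_char_pow, one_pow, ← pow_mul, ← haj']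
      simp
    · intro b _ hb
      simp [hb]
    · exact fun h => absurd hj0J h

lemma exists_good_root {p : ℕ} (hp : p.Prime) [Fact p.Prime] {j : ℕ} (hj : ¬ p ∣ j) :
    ∃ z : AlgebraicClosure (ZMod p), 1 + z ^ j = 0 ∧ ∀ i, 0 < i → i < j → 1 + z ^ i ≠ 0 := by
  haveI : CharP (AlgebraicClosure (ZMod p)) p :=
    charP_of_injective_algebraMap (algebraMap (ZMod p) _).injective p
  have hj0 : j ≠ 0 := fun h => hj (h ▸ dvd_zero p)
  by_cases h2 : p = 2
  · subst h2
    haveI : NeZero (j : AlgebraicClosure (ZMod 2)) :=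
      ⟨fun h => hj ((CharP.cast_eq_zero_iff _ 2 j).1 h)⟩
    obtain ⟨z, hz⟩ := HasEnoughRootsOfUnity.exists_primitiveRoot (AlgebraicClosure (ZMod 2)) j
    refine ⟨z, ?_, ?_⟩
    · rw [hz.pow_eq_one]
      exact CharTwo.add_self_eq_zero 1
    · intro i hi hij h
      have : z ^ i = 1 := by
        have := eq_neg_of_add_eq_zero_right h
        rwa [CharTwo.neg_eq] at this
      exact absurd (Nat.le_of_dvd hi (hz.dvd_of_pow_eq_one _ this)) (by omega)
  · have h2j : ¬ p ∣ 2 * j := by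
      intro h
      rcases hp.dvd_mul.1 h with h | h
      · exact h2 ((Nat.prime_dvd_prime_iff_eq hp Nat.prime_two).1 h)
      · exact hj h
    haveI : NeZero ((2 * j : ℕ) : AlgebraicClosure (ZMod p)) :=
      ⟨fun h => h2j ((CharP.cast_eq_zero_iff _ p _).1 h)⟩
    obtain ⟨z, hz⟩ :=
      HasEnoughRootsOfUnity.exists_primitiveRoot (AlgebraicClosure (ZMod p)) (2 * j)
    refine ⟨z, ?_, ?_⟩
    · have h1 : (z ^ j - 1) * (1 + z ^ j) = 0 := by
        have := hz.pow_eq_one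
        rw [mul_comm 2 j, pow_mul] at this
        linear_combination this
      rcases mul_eq_zero.1 h1 with h | h
      · exfalso
        have := Nat.le_of_dvd (by omega) (hz.dvd_of_pow_eq_one _ (sub_eq_zero.1 h))
        omega
      · exact h
    · intro i hi hij h
      have : z ^ (2 * i) = 1 := by
        have := eq_neg_of_add_eq_zero_right h
        rw [mul_comm, pow_mul, this]; ring
      have := Nat.le_of_dvd (by omega) (hz.dvd_of_pow_eq_one _ this)
      omega

open Polynomial in
lemma prod_unique {p : ℕ} (hp : p.Prime) (J : Finset ℕ) (hJ : ∀ j ∈ J, ¬ p ∣ j)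
    (c d : ℕ → ℕ)
    (h : (∏ j ∈ J, (1 + X ^ j : (ZMod p)[X]) ^ c j) = ∏ j ∈ J, (1 + X ^ j) ^ d j) :
    ∀ j ∈ J, c j = d j := by
  haveI : Fact p.Prime := ⟨hp⟩
  by_contra hcon
  push Not at hcon
  obtain ⟨j1, hj1, hne1⟩ := hcon
  let T := J.filter fun j => c j ≠ d j
  have hT : T.Nonempty := ⟨j1, Finset.mem_filter.2 ⟨hj1, hne1⟩⟩
  let j := T.max' hT
  have hjT : j ∈ T := T.max'_mem hT
  obtain ⟨hjJ, hne⟩ := Finset.mem_filter.1 hjT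
  obtain ⟨z, hz0, hz⟩ := exists_good_root hp (hJ j hjJ)
  let K := AlgebraicClosure (ZMod p)
  have hnz : ∀ i ∈ J, (1 + X ^ i : K[X]) ≠ 0 := by
    intro i hi h0
    have hi0 : i ≠ 0 := fun h => hJ i hi (h ▸ dvd_zero p)
    have := congrArg (fun f => coeff f i) h0
    simp [coeff_one, hi0] at this
  have hmult : ∀ e : ℕ → ℕ, (∏ i ∈ J, (1 + X ^ i : K[X]) ^ e i).roots.count z =
      ∑ i ∈ J, e i * (1 + X ^ i : K[X]).roots.count z := by
    intro e
    rw [roots_prod _ _ (Finset.prod_ne_zero_iff.2 fun i hi => pow_ne_zero _ (hnz i hi))]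
    rw [Multiset.count_bind]
    refine Finset.sum_congr rfl fun i _ => ?_
    rw [roots_pow, Multiset.count_nsmul]
  have hK := congrArg (Polynomial.map (algebraMap (ZMod p) K)) h
  simp only [Polynomial.map_prod, Polynomial.map_pow, Polynomial.map_add, Polynomial.map_one,
    Polynomial.map_X] at hK
  have hsum := congrArg (fun f => f.roots.count z) hK
  simp only [hmult] at hsum
  rw [← Finset.add_sum_erase _ _ hjJ, ← Finset.add_sum_erase _ _ hjJ] at hsum
  have hrest : ∑ i ∈ J.erase j, c i * (1 + X ^ i : K[X]).roots.count z =
      ∑ i ∈ J.erase j, d i * (1 + X ^ i : K[X]).roots.count z := by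
    refine Finset.sum_congr rfl fun i hi => ?_
    obtain ⟨hij, hiJ⟩ := Finset.mem_erase.1 hi
    rcases lt_or_gt_of_ne hij with hlt | hgt
    · have : (1 + X ^ i : K[X]).roots.count z = 0 := by
        rw [Multiset.count_eq_zero]
        intro hmem
        have := isRoot_of_mem_roots hmem
        have hi0 : i ≠ 0 := fun h => hJ i hiJ (h ▸ dvd_zero p)
        exact hz i (Nat.pos_of_ne_zero hi0) hlt (by simpa [IsRoot] using this)
      simp [this]
    · have : c i = d i := by
        by_contra hcd
        have := T.le_max' i (Finset.mem_filter.2 ⟨hiJ, hcd⟩)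
        exact absurd this (not_le.2 hgt)
      rw [this]
  rw [hrest] at hsum
  have hpos : 0 < (1 + X ^ j : K[X]).roots.count z := by
    rw [Multiset.count_pos, mem_roots (hnz j hjJ)]
    simpa [IsRoot] using hz0
  exact hne (Nat.eq_of_mul_eq_mul_right hpos (Nat.add_right_cancel hsum))

lemma wsum_large {p : ℕ} {w : ℕ} (mu : Nat.Partition w) {j : ℕ} (hp : p.Prime)
    (hj : w < j) : wsum p j mu.parts = 0 := by
  unfold wsum
  rw [finsum_eq_zero_of_forall_eq_zero]
  intro n
  rw [Multiset.count_eq_zero.2, zero_mul]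
  intro hmem
  have h1 := Multiset.le_sum_of_mem hmem
  rw [mu.parts_sum] at h1
  have := Nat.le_mul_of_pos_right j (pow_pos hp.pos n)
  omega

lemma samePBlock_iff {p : ℕ} (hp : p.Prime) {w : ℕ} (lam mu : Nat.Partition w) :
    samePBlock p lam.parts mu.parts ↔
      (PP lam.parts).map (Int.castRingHom (ZMod p)) =
        (PP mu.parts).map (Int.castRingHom (ZMod p)) := by
  let J := (Finset.range (w + 1)).filter fun j => ¬ p ∣ j
  have hJ : ∀ j ∈ J, ¬ p ∣ j := fun j hj => (Finset.mem_filter.1 hj).2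
  have hmem : ∀ nu : Nat.Partition w, ∀ i ∈ nu.parts, ∀ j, j ∣ i → ¬ p ∣ j → j ∈ J := by
    intro nu i hi j hji hpj
    refine Finset.mem_filter.2 ⟨?_, hpj⟩
    have h1 := Multiset.le_sum_of_mem hi
    rw [nu.parts_sum] at h1
    have := Nat.le_of_dvd (nu.parts_pos hi) hji
    rw [Finset.mem_range]
    omega
  rw [PP_map_eq hp J hJ _ (fun i hi => lam.parts_pos hi) (hmem lam),
    PP_map_eq hp J hJ _ (fun i hi => mu.parts_pos hi) (hmem mu)]
  constructor
  · intro h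
    exact Finset.prod_congr rfl fun j hj => by rw [h j (hJ j hj)]
  · intro h j hj
    by_cases hjw : j ≤ w
    · exact prod_unique hp J hJ _ _ h j (Finset.mem_filter.2 ⟨Finset.mem_range.2 (by omega), hj⟩)
    · rw [wsum_large lam hp (by omega), wsum_large mu hp (by omega)]

lemma wsum_big_prime {q w : ℕ} (hq : w < q) (mu : Nat.Partition w) {j : ℕ} (hj : j ≠ 0) :
    wsum q j mu.parts = mu.parts.count j := by
  unfold wsum
  rw [finsum_eq_single _ 0]
  · simp
  · intro n hn
    rw [Multiset.count_eq_zero.2, zero_mul]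
    intro hmem
    have h1 := Multiset.le_sum_of_mem hmem
    rw [mu.parts_sum] at h1
    have h2 : q ≤ q ^ n := Nat.le_self_pow hn q
    have h3 := Nat.le_mul_of_pos_left (q ^ n) (Nat.pos_of_ne_zero hj)
    omega

lemma sep_int {w : ℕ} (a b : Nat.Partition w) (hab : a ≠ b) :
    ∃ k, (PP a.parts).coeff k ≠ (PP b.parts).coeff k := by
  by_contra hcon
  push Not at hcon
  have hPP : PP a.parts = PP b.parts := Polynomial.ext hcon
  obtain ⟨q, hwq, hq⟩ := Nat.exists_infinite_primes (w + 1)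
  have hs := (samePBlock_iff hq a b).2 (by rw [hPP])
  apply hab
  apply Nat.Partition.ext
  ext j
  by_cases hj : j = 0
  · subst hj
    rw [Multiset.count_eq_zero.2 fun h => lt_irrefl _ (a.parts_pos h),
      Multiset.count_eq_zero.2 fun h => lt_irrefl _ (b.parts_pos h)]
  · rw [← wsum_big_prime (q := q) (by omega) a hj, ← wsum_big_prime (q := q) (by omega) b hj]
    by_cases hjw : q ∣ j
    · have := Nat.le_of_dvd (Nat.pos_of_ne_zero hj) hjw
      rw [wsum_large a hq (by omega), wsum_large b hq (by omega)]
    · exact hs j hjw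

lemma sep_mod {p : ℕ} (hp : p.Prime) {w : ℕ} (a b : Nat.Partition w)
    (hab : ¬ samePBlock p a.parts b.parts) :
    ∃ k, ¬ (p : ℤ) ∣ (PP a.parts).coeff k - (PP b.parts).coeff k := by
  by_contra hcon
  push Not at hcon
  apply hab
  rw [samePBlock_iff hp]
  ext k
  simp only [Polynomial.coeff_map, eq_intCast]
  rw [← sub_eq_zero, ← Int.cast_sub, ZMod.intCast_zmod_eq_zero_iff_dvd]
  exact hcon k

lemma const_mod {p : ℕ} (hp : p.Prime) {w : ℕ} (a b : Nat.Partition w)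
    (hab : samePBlock p a.parts b.parts) (k : ℕ) :
    (p : ℤ) ∣ (PP a.parts).coeff k - (PP b.parts).coeff k := by
  have h := congrArg (fun f => Polynomial.coeff f k) ((samePBlock_iff hp a b).1 hab)
  simp only [Polynomial.coeff_map, eq_intCast] at h
  rwa [← sub_eq_zero, ← Int.cast_sub, ZMod.intCast_zmod_eq_zero_iff_dvd] at h

/-! ### Conclusion -/

/-- Lagrange-type products lie in the row space -/
lemma lagrange_mem (p : ℕ) (hp : p.Prime) (w : ℕ) (S : Finset (Nat.Partition w))
    (k : Nat.Partition w → ℕ) :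
    (fun mu : Nat.Partition w =>
      ((∏ b ∈ S, ((PP mu.parts).coeff (k b) - (PP b.parts).coeff (k b)) : ℤ) : ℚ)) ∈
      VA p hp w := by
  have : (fun mu : Nat.Partition w =>
      ((∏ b ∈ S, ((PP mu.parts).coeff (k b) - (PP b.parts).coeff (k b)) : ℤ) : ℚ)) =
      ∏ b ∈ S, ((fun mu : Nat.Partition w => ((PP mu.parts).coeff (k b) : ℚ)) -
        (((PP b.parts).coeff (k b) : ℤ) : Nat.Partition w → ℚ)) := by
    ext mu
    simp [Finset.prod_apply]
  rw [this]
  exact prod_mem fun b _ => sub_mem (PP_coeff_mem p hp w (k b)) (intCast_mem _ _)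

lemma single_mem (p : ℕ) (hp : p.Prime) (w : ℕ) (a : Nat.Partition w) :
    ∃ D : ℤ, D ≠ 0 ∧ (Pi.single a (D : ℚ) : Nat.Partition w → ℚ) ∈ VA p hp w := by
  have : ∀ b, ∃ k, a ≠ b → (PP a.parts).coeff k ≠ (PP b.parts).coeff k := by
    intro b
    by_cases h : a = b
    · exact ⟨0, fun h' => absurd h h'⟩
    · obtain ⟨k, hk⟩ := sep_int a b h
      exact ⟨k, fun _ => hk⟩
  choose k hk using this
  refine ⟨∏ b ∈ Finset.univ.erase a, ((PP a.parts).coeff (k b) - (PP b.parts).coeff (k b)),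
    ?_, ?_⟩
  · refine Finset.prod_ne_zero_iff.2 fun b hb => sub_ne_zero.2 (hk b ?_)
    exact (Finset.ne_of_mem_erase hb).symm
  · convert lagrange_mem p hp w (Finset.univ.erase a) k using 1
    ext mu
    by_cases h : mu = a
    · subst h
      simp
    · rw [Pi.single_eq_of_ne h, Finset.prod_eq_zero (i := mu)]
      · simp
      · simp [h]
      · simp

lemma all_single_mem (p : ℕ) (hp : p.Prime) (w : ℕ) :
    ∃ N : ℕ, ∀ h : Nat.Partition w → ℤ,
      (fun mu => (((p : ℤ) ^ N * h mu : ℤ) : ℚ)) ∈ VA p hp w := by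
  choose D hD hmem using single_mem p hp w
  have hp1 : ¬ IsUnit (p : ℤ) := (Nat.prime_iff_prime_int.mp hp).not_unit
  have hE : (∏ a, D a) ≠ 0 := Finset.prod_ne_zero_iff.2 fun a _ => hD a
  have hfin : FiniteMultiplicity (p : ℤ) (∏ a, D a) :=
    Int.finiteMultiplicity_iff.2 ⟨by simpa using hp.ne_one, hE⟩
  obtain ⟨u, hu, hpu⟩ := hfin.exists_eq_pow_mul_and_not_dvd
  refine ⟨multiplicity (p : ℤ) (∏ a, D a), fun h => ?_⟩
  set N := multiplicity (p : ℤ) (∏ a, D a)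
  have hu0 : (u : ℚ) ≠ 0 := by
    intro h0
    have : u = 0 := by exact_mod_cast h0
    exact hpu (this ▸ dvd_zero _)
  have hc : ∀ a, ∃ c : Zploc p hp, (c : ℚ) =
      ((h a * ∏ b ∈ Finset.univ.erase a, D b : ℤ) : ℚ) / (u : ℚ) := fun a =>
    ⟨⟨_, ⟨_, u, hpu, rfl⟩⟩, rfl⟩
  choose c hc using hc
  have : (fun mu => (((p : ℤ) ^ N * h mu : ℤ) : ℚ)) =
      ∑ a, c a • (Pi.single a (D a : ℚ) : Nat.Partition w → ℚ) := by
    ext mu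
    rw [Finset.sum_apply, Finset.sum_eq_single mu]
    · rw [Pi.smul_apply, Pi.single_eq_same, Subring.smul_def, hc, smul_eq_mul]
      have h1 : ((∏ b ∈ Finset.univ.erase mu, D b) : ℤ) * D mu = (p : ℤ) ^ N * u := by
        rw [← hu, mul_comm, Finset.mul_prod_erase _ _ (Finset.mem_univ mu)]
      have h2 := congrArg (fun z : ℤ => (z : ℚ)) h1
      simp only [Int.cast_mul] at h2 ⊢
      field_simp
      linear_combination (-(h mu : ℚ)) * h2
    · intro b _ hb
      rw [Pi.smul_apply, Pi.single_eq_of_ne hb.symm, smul_zero]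
    · simp
  rw [this]
  exact sum_mem fun a _ => (VA p hp w).smul_mem (hmem a) (c a)

lemma samePBlock_trans {p : ℕ} {a b c : Multiset ℕ} (h1 : samePBlock p a b)
    (h2 : samePBlock p b c) : samePBlock p a c := fun j hj => (h1 j hj).trans (h2 j hj)

lemma indicator_mem (p : ℕ) (hp : p.Prime) (w : ℕ) (lam0 : Nat.Partition w) :
    (fun mu : Nat.Partition w => if samePBlock p lam0.parts mu.parts then (1 : ℚ) else 0) ∈
      VA p hp w := by
  obtain ⟨N, hN⟩ := all_single_mem p hp w
  have : ∀ b : Nat.Partition w, ∃ k, ¬ samePBlock p lam0.parts b.parts →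
      ¬ (p : ℤ) ∣ (PP lam0.parts).coeff k - (PP b.parts).coeff k := by
    intro b
    by_cases h : samePBlock p lam0.parts b.parts
    · exact ⟨0, fun h' => absurd h h'⟩
    · obtain ⟨k, hk⟩ := sep_mod hp _ _ h
      exact ⟨k, fun _ => hk⟩
  choose k hk using this
  have hpi : Prime (p : ℤ) := Nat.prime_iff_prime_int.mp hp
  let S : Finset (Nat.Partition w) :=
    Finset.univ.filter fun b => ¬ samePBlock p lam0.parts b.parts
  let g : Nat.Partition w → ℤ := fun mu =>
    ∏ b ∈ S, ((PP mu.parts).coeff (k b) - (PP b.parts).coeff (k b))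
  let t := (p ^ (N + 1)).totient
  have ht : N ≤ t := by
    have : t = p ^ N * (p - 1) := by
      simp only [t]
      rw [Nat.totient_prime_pow_succ hp]
    rw [this]
    have h1 : N < p ^ N := Nat.lt_pow_self hp.one_lt
    have h2 := Nat.le_mul_of_pos_right (p ^ N) (Nat.sub_pos_of_lt hp.one_lt)
    omega
  have hon : ∀ mu : Nat.Partition w, samePBlock p lam0.parts mu.parts →
      (p : ℤ) ^ N ∣ 1 - g mu ^ t := by
    intro mu hmu
    have hng : ¬ (p : ℤ) ∣ g mu := by
      intro hd
      obtain ⟨b, hb, hdb⟩ := (hpi.dvd_finset_prod_iff _).1 hd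
      have hb' := (Finset.mem_filter.1 hb).2
      apply hk b hb'
      have := dvd_add (const_mod hp _ _ hmu (k b)) hdb
      simpa using this
    have hcop : IsCoprime (g mu) ((p ^ (N + 1) : ℕ) : ℤ) := by
      push_cast
      exact ((hpi.coprime_iff_not_dvd.2 hng).symm).pow_right
    have h1 : (g mu) ^ t ≡ 1 [ZMOD ((p ^ (N + 1) : ℕ) : ℤ)] := by
      rw [← ZMod.intCast_eq_intCast_iff]
      have hunit : IsUnit ((g mu : ℤ) : ZMod (p ^ (N + 1))) := by
        obtain ⟨x, y, hxy⟩ := hcop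
        refine IsUnit.of_mul_eq_one (x : ZMod (p ^ (N + 1))) ?_
        have := congrArg (fun z : ℤ => (z : ZMod (p ^ (N + 1)))) hxy
        simp only [Int.cast_add, Int.cast_mul, Int.cast_natCast, ZMod.natCast_self, mul_zero,
          add_zero, Int.cast_one] at this
        rw [mul_comm]; exact this
      obtain ⟨v, hv⟩ := hunit
      push_cast
      rw [← hv, ← Units.val_pow_eq_pow_val, ZMod.pow_totient]
      rfl
    have h2 := h1.dvd
    refine dvd_trans ?_ h2
    push_cast
    exact pow_dvd_pow _ (Nat.le_succ N)
  have hoff : ∀ mu : Nat.Partition w, ¬ samePBlock p lam0.parts mu.parts →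
      (p : ℤ) ^ N ∣ 0 - g mu ^ t := by
    intro mu hmu
    have hg : g mu = 0 :=
      Finset.prod_eq_zero (i := mu) (Finset.mem_filter.2 ⟨Finset.mem_univ _, hmu⟩) (sub_self _)
    have ht0 : t ≠ 0 := (Nat.totient_pos.2 (pow_pos hp.pos _)).ne'
    simp [hg, ht0]
  have hex : ∀ mu : Nat.Partition w, ∃ h : ℤ,
      (if samePBlock p lam0.parts mu.parts then (1 : ℤ) else 0) - g mu ^ t = (p : ℤ) ^ N * h := by
    intro mu
    by_cases hmu : samePBlock p lam0.parts mu.parts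
    · rw [if_pos hmu]; exact hon mu hmu
    · rw [if_neg hmu]; exact hoff mu hmu
  choose h hh using hex
  have hg : (fun mu => (g mu : ℚ)) ∈ VA p hp w := lagrange_mem p hp w S k
  have heq : (fun mu : Nat.Partition w =>
      if samePBlock p lam0.parts mu.parts then (1 : ℚ) else 0) =
      (fun mu => (((p : ℤ) ^ N * h mu : ℤ) : ℚ)) + (fun mu => (g mu : ℚ)) ^ t := by
    ext mu
    rw [Pi.add_apply, Pi.pow_apply, ← hh mu]
    push_cast
    split_ifs <;> ring
  rw [heq]
  exact add_mem (hN h) (pow_mem hg t)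

/-- **Proposition 4.4.** The matrix `M = M(h, p̃; w)` splits over `ℤ_(p)` with respect to the
set partition `Par(w) = ⊔_{ν ∈ Par'(w)} Par(w, ν)`: the projection of any element of the
row space (over `ℤ_(p)`) onto any block again lies in the row space. -/
theorem M_splits (p : ℕ) (hp : p.Prime) (w : ℕ) (lam0 : Nat.Partition w)
    (x : Nat.Partition w → ℚ)
    (hx : x ∈ Submodule.span (Zploc p hp)
        (Set.range (fun lam : Nat.Partition w => Mmat w lam))) :
    (fun mu : Nat.Partition w => if samePBlock p lam0.parts mu.parts then x mu else 0)
      ∈ Submodule.span (Zploc p hp)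
          (Set.range (fun lam : Nat.Partition w => Mmat w lam)) := by
  have h := mul_mem_VV p hp w _ _ (indicator_mem p hp w lam0) hx
  change _ ∈ VV p hp w
  convert h using 1
  ext mu
  simp

end
end

section
/- Fix a prime p and w ≥ 0. Let M = M(h, p̃; w) be the Par(w)×Par(w)-matrix with M_{λμ} = |𝓜_{λμ}|. For ν ∈ Par'(w), let L(ν) = ⊗_{j prime to p} N^{(m_j(ν))}, a matrix with rows and columns indexed by Π_j Pow(m_j(ν)), and define the Par(w)×Par(w)-matrix L by: L_{λμ} = L(ν)_{ι(λ), ι(μ)} if λ, μ ∈ Par(w,ν) for some ν ∈ Par'(w), and L_{λμ} = 0 otherwise. Then M and L are row equivalent over ℤ_(p). -/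
open scoped BigOperators
open Classical

noncomputable section

/-- The component `ι(λ)_j ∈ Pow(m_j(ν))` of the bijection
`ι : Par(w, ν) ≃ ∏_j Pow(m_j(ν))`, given (as a multiset) by `m_{p^n}(ι(λ)_j) = m_{j p^n}(λ)`. -/
def iotaM (p w : ℕ) (lam : Multiset ℕ) (j : ℕ) : Multiset ℕ :=
  ∑ n ∈ Finset.range (w + 1), Multiset.replicate (lam.count (j * p ^ n)) (p ^ n)

/-- The block-diagonal matrix `L`, with block at `ν ∈ Par'(w)` equal to
`L(ν) = ⊗_{j prime to p} N^{(m_j(ν))}` (transported along `ι`):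
`L_{λμ} = ∏_j N^{(m_j(ν))}_{ι(λ)_j, ι(μ)_j}` if `λ, μ ∈ Par(w, ν)`, and `0` otherwise. -/
def Lmat (p w : ℕ) : Matrix (Nat.Partition w) (Nat.Partition w) ℚ :=
  Matrix.of fun lam mu =>
    if samePBlock p lam.parts mu.parts then
      ∏ j ∈ (Finset.range (w + 1)).filter (fun j => ¬ p ∣ j),
        (Mcount (iotaM p w lam.parts j) (iotaM p w mu.parts j) : ℚ)
    else 0

def fctQ (c : ℕ →₀ ℕ) : ℚ := c.prod fun _ m => (m.factorial : ℚ)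

lemma fctQ_ne (c : ℕ →₀ ℕ) : fctQ c ≠ 0 := by
  unfold fctQ
  rw [Finsupp.prod, Finset.prod_ne_zero_iff]
  intro a _
  exact_mod_cast Nat.factorial_ne_zero _

lemma fctQ_add_single (c : ℕ →₀ ℕ) (k : ℕ) :
    fctQ (c + Finsupp.single k 1) = fctQ c * (c k + 1) := by
  unfold fctQ
  have hs : (c + Finsupp.single k 1).support ⊆ insert k c.support := by
    intro x hx
    by_cases h : x = k
    · simp [h]
    · simp only [Finset.mem_insert, h, false_or, Finsupp.mem_support_iff] at hx ⊢
      simpa [Finsupp.single_apply, Ne.symm h] using hx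
  rw [Finsupp.prod_of_support_subset _ hs _ (by simp),
    Finsupp.prod_of_support_subset c (Finset.subset_insert k c.support) _ (by simp)]
  rw [← Finset.mul_prod_erase _ _ (Finset.mem_insert_self k c.support),
    ← Finset.mul_prod_erase _ (fun x => ((c x).factorial : ℚ)) (Finset.mem_insert_self k c.support)]
  have : ∀ x ∈ (insert k c.support).erase k,
      ((((c + Finsupp.single k 1 : ℕ →₀ ℕ) x).factorial : ℕ) : ℚ) = ((c x).factorial : ℚ) := by
    intro x hx
    have : x ≠ k := (Finset.mem_erase.mp hx).1
    simp [Finsupp.single_apply, this.symm]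
  rw [Finset.prod_congr rfl this]
  simp [Nat.factorial_succ]
  ring

/-- `c! * coeff c`. -/
def Phi (c : ℕ →₀ ℕ) : MvPowerSeries ℕ ℚ →ₗ[ℚ] ℚ := fctQ c • MvPowerSeries.coeff c

lemma Phi_apply (c : ℕ →₀ ℕ) (P : MvPowerSeries ℕ ℚ) :
    Phi c P = fctQ c * MvPowerSeries.coeff c P := rfl

lemma Phi_ext {P Q : MvPowerSeries ℕ ℚ} (h : ∀ c, Phi c P = Phi c Q) : P = Q := by
  ext c
  have := h c
  rw [Phi_apply, Phi_apply] at this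
  exact mul_left_cancel₀ (fctQ_ne c) this

lemma Phi_pderiv (c : ℕ →₀ ℕ) (k : ℕ) (P : MvPowerSeries ℕ ℚ) :
    Phi c (MvPowerSeries.pderiv ℚ k P) = Phi (c + Finsupp.single k 1) P := by
  rw [Phi_apply, Phi_apply, MvPowerSeries.coeff_pderiv, fctQ_add_single]
  ring

lemma Phi_zero_mul (P Q : MvPowerSeries ℕ ℚ) : Phi 0 (P * Q) = Phi 0 P * Phi 0 Q := by
  simp [Phi_apply, fctQ]

lemma Phi_zero_prod {I : Type*} (s : Finset I) (P : I → MvPowerSeries ℕ ℚ) :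
    Phi 0 (∏ i ∈ s, P i) = ∏ i ∈ s, Phi 0 (P i) := by
  simp [Phi_apply, fctQ, map_prod]

def wtF (c : ℕ →₀ ℕ) : ℤ := c.sum fun k m => (k : ℤ) * m

def goodF (K : Set ℕ) (n : ℤ) (c : ℕ →₀ ℕ) : Prop :=
  wtF c = n ∧ ∀ k, c k ≠ 0 → (k ∈ K ∧ 0 < k)

def hh (K : Set ℕ) (n : ℤ) : MvPowerSeries ℕ ℚ :=
  fun c => if goodF K n c then (fctQ c)⁻¹ else 0

lemma Phi_hh (K : Set ℕ) (n : ℤ) (c : ℕ →₀ ℕ) :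
    Phi c (hh K n) = if goodF K n c then 1 else 0 := by
  rw [Phi_apply]
  have : MvPowerSeries.coeff c (hh K n) = if goodF K n c then (fctQ c)⁻¹ else 0 := rfl
  rw [this]
  split_ifs
  · exact mul_inv_cancel₀ (fctQ_ne c)
  · simp

lemma wtF_add_single (c : ℕ →₀ ℕ) (k : ℕ) : wtF (c + Finsupp.single k 1) = wtF c + k := by
  unfold wtF
  rw [Finsupp.sum_add_index' (by simp) (by intros; push_cast; ring)]
  simp

lemma goodF_add_single (K : Set ℕ) (n : ℤ) (c : ℕ →₀ ℕ) (k : ℕ) :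
    goodF K n (c + Finsupp.single k 1) ↔ (k ∈ K ∧ 0 < k) ∧ goodF K (n - k) c := by
  unfold goodF
  rw [wtF_add_single]
  constructor
  · rintro ⟨h1, h2⟩
    refine ⟨h2 k (by simp), by omega, fun x hx => h2 x ?_⟩
    simp; omega
  · rintro ⟨h0, h1, h2⟩
    refine ⟨by omega, fun x hx => ?_⟩
    by_cases h : x = k
    · rw [h]; exact h0
    · apply h2
      simpa [Finsupp.single_apply, Ne.symm h] using hx

lemma pderiv_hh (K : Set ℕ) (n : ℤ) (k : ℕ) :
    MvPowerSeries.pderiv ℚ k (hh K n) = if (k ∈ K ∧ 0 < k) then hh K (n - k) else 0 := by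
  apply Phi_ext
  intro c
  rw [Phi_pderiv, Phi_hh]
  by_cases h : k ∈ K ∧ 0 < k
  · rw [if_pos h, Phi_hh]
    simp only [goodF_add_single, h, true_and]
  · rw [if_neg h, map_zero, if_neg]
    rw [goodF_add_single]
    exact fun h' => h h'.1

lemma deriv_prod (k : ℕ) {I : Type*} (s : Finset I) (P : I → MvPowerSeries ℕ ℚ) :
    MvPowerSeries.pderiv ℚ k (∏ i ∈ s, P i) =
      ∑ i ∈ s, MvPowerSeries.pderiv ℚ k (P i) * ∏ x ∈ s.erase i, P x := by
  induction s using Finset.induction_on with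
  | empty => simp
  | insert a s ha ih =>
    rw [Finset.prod_insert ha, Derivation.leibniz, ih, Finset.sum_insert ha,
      Finset.erase_insert ha, smul_eq_mul, smul_eq_mul, Finset.mul_sum, add_comm, mul_comm]
    congr 1
    apply Finset.sum_congr rfl
    intro i hi
    have hia : a ≠ i := fun h => ha (h ▸ hi)
    rw [Finset.erase_insert_of_ne hia, Finset.prod_insert (by simp [ha])]
    ring

lemma deriv_prod_hh (k : ℕ) {I : Type*} [Fintype I] (K : I → Set ℕ) (W : I → ℤ) :
    MvPowerSeries.pderiv ℚ k (∏ i, hh (K i) (W i)) =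
      ∑ i, if (k ∈ K i ∧ 0 < k) then ∏ x, hh (K x) (W x - if i = x then (k : ℤ) else 0) else 0 := by
  rw [deriv_prod]
  apply Finset.sum_congr rfl
  intro i hi
  rw [pderiv_hh]
  split_ifs with h
  · rw [← Finset.mul_prod_erase _ _ hi]
    simp only [if_true]
    congr 1
    apply Finset.prod_congr rfl
    intro x hx
    have : i ≠ x := (Finset.ne_of_mem_erase hx).symm
    simp [this]
  · simp

/-- condition on maps. -/
def mcond {J I : Type*} [Fintype J] (wt : J → ℕ) (K : I → Set ℕ) (W : I → ℤ) (f : J → I) : Prop :=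
  (∀ x, wt x ∈ K (f x) ∧ 0 < wt x) ∧ ∀ i, (∑ x, if f x = i then (wt x : ℤ) else 0) = W i

def cvec {J : Type*} [Fintype J] (wt : J → ℕ) : ℕ →₀ ℕ := ∑ x, Finsupp.single (wt x) 1

theorem Phi_prod_hh {I : Type*} [Fintype I] (K : I → Set ℕ) :
    ∀ (n : ℕ) (wt : Fin n → ℕ) (W : I → ℤ),
    Phi (cvec wt) (∏ i, hh (K i) (W i)) =
      ∑ f : Fin n → I, if mcond wt K W f then 1 else 0 := by
  intro n
  induction n with
  | zero =>
    intro wt W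
    have : cvec wt = 0 := by simp [cvec]
    rw [this, Phi_zero_prod]
    simp only [Phi_hh]
    rw [Fintype.sum_unique, Finset.prod_ite_zero]
    simp [mcond, goodF, wtF]
  | succ n ih =>
    intro wt W
    have hc : cvec wt = cvec (fun x : Fin n => wt x.succ) + Finsupp.single (wt 0) 1 := by
      simp [cvec, Fin.sum_univ_succ, add_comm]
    rw [hc, ← Phi_pderiv, deriv_prod_hh, map_sum]
    rw [← (Fin.consEquiv (fun _ => I)).sum_comp, Fintype.sum_prod_type]
    apply Finset.sum_congr rfl
    intro i _
    have key : ∀ f : Fin n → I, mcond wt K W ((Fin.consEquiv (fun _ => I)) (i, f)) ↔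
        (wt 0 ∈ K i ∧ 0 < wt 0) ∧ mcond (fun x : Fin n => wt x.succ) K
          (fun x => W x - if i = x then ((wt 0 : ℕ) : ℤ) else 0) f := by
      intro f
      simp only [mcond, Fin.forall_fin_succ, Fin.sum_univ_succ, Fin.consEquiv_apply, Fin.cons_zero,
        Fin.cons_succ, eq_sub_iff_add_eq, and_assoc, add_comm]
    simp only [key]
    split_ifs with h
    · rw [ih]
      simp only [h, true_and, and_self]
    · simp [h]

lemma exists_cvec (c : ℕ →₀ ℕ) : ∃ (n : ℕ) (wt : Fin n → ℕ), cvec wt = c := by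
  induction c using Finsupp.induction_linear with
  | zero => exact ⟨0, fun _ => 0, by simp [cvec]⟩
  | add f g hf hg =>
    obtain ⟨n, a, rfl⟩ := hf
    obtain ⟨m, b, rfl⟩ := hg
    exact ⟨n + m, Fin.append a b, by simp [cvec, Fin.sum_univ_add]⟩
  | single k m => exact ⟨m, fun _ => k, by simp [cvec]⟩

lemma Phi_ext' {P Q : MvPowerSeries ℕ ℚ}
    (h : ∀ (n : ℕ) (wt : Fin n → ℕ), Phi (cvec wt) P = Phi (cvec wt) Q) : P = Q := by
  apply Phi_ext
  intro c
  obtain ⟨n, wt, rfl⟩ := exists_cvec c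
  exact h n wt

lemma wtF_add (c d : ℕ →₀ ℕ) : wtF (c + d) = wtF c + wtF d := by
  unfold wtF
  rw [Finsupp.sum_add_index' (by simp) (by intros; push_cast; ring)]

lemma wtF_cvec {n : ℕ} (wt : Fin n → ℕ) : wtF (cvec wt) = ∑ x, (wt x : ℤ) := by
  induction n with
  | zero => simp [cvec, wtF]
  | succ n ih =>
    have hc : cvec wt = cvec (fun x : Fin n => wt x.succ) + Finsupp.single (wt 0) 1 := by
      simp [cvec, Fin.sum_univ_succ, add_comm]
    rw [hc, wtF_add_single, ih, Fin.sum_univ_succ, add_comm]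

lemma cvec_apply {n : ℕ} (wt : Fin n → ℕ) (k : ℕ) : cvec wt k ≠ 0 ↔ ∃ x, wt x = k := by
  simp [cvec, Finsupp.finsetSum_apply, Finsupp.single_apply]

lemma goodF_cvec {n : ℕ} (K : Set ℕ) (m : ℤ) (wt : Fin n → ℕ) :
    goodF K m (cvec wt) ↔ (∑ x, (wt x : ℤ)) = m ∧ ∀ x, wt x ∈ K ∧ 0 < wt x := by
  unfold goodF
  rw [wtF_cvec]
  simp only [cvec_apply]
  aesop

def fib {J I : Type*} [Fintype J] (wt : J → ℕ) (f : J → I) (i : I) : ℤ :=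
  ∑ x, if f x = i then (wt x : ℤ) else 0

lemma sum_fib_s15 {J I : Type*} [Fintype J] [Fintype I] (wt : J → ℕ) (f : J → I) :
    ∑ i, fib wt f i = ∑ x, (wt x : ℤ) := by
  unfold fib
  rw [Finset.sum_comm]
  simp

/-- sums of products over weight functions of total weight `m` satisfying `C`. -/
def PW {I : Type*} [Fintype I] (K : I → Set ℕ) (m : ℤ) (C : (I → ℤ) → Prop) :
    MvPowerSeries ℕ ℚ :=
  ∑ W ∈ (Fintype.piFinset fun _ : I => Finset.Icc 0 m).filter (fun W => ∑ i, W i = m ∧ C W),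
    ∏ i, hh (K i) (W i)

lemma Phi_PW {I : Type*} [Fintype I] (K : I → Set ℕ) (m : ℤ) (C : (I → ℤ) → Prop)
    {n : ℕ} (wt : Fin n → ℕ) :
    Phi (cvec wt) (PW K m C) = ∑ f : Fin n → I,
      if ((∀ x, wt x ∈ K (f x) ∧ 0 < wt x) ∧ (∑ x, (wt x : ℤ)) = m ∧ C (fib wt f)) then 1 else 0 := by
  unfold PW
  rw [map_sum]
  simp only [Phi_prod_hh]
  rw [Finset.sum_comm]
  apply Finset.sum_congr rfl
  intro f _
  have h1 : ∀ W : I → ℤ, mcond wt K W f ↔ (∀ x, wt x ∈ K (f x) ∧ 0 < wt x) ∧ fib wt f = W := by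
    intro W
    rw [funext_iff]
    rfl
  simp only [h1]
  by_cases h : ∀ x, wt x ∈ K (f x) ∧ 0 < wt x
  · simp only [h, true_and, Finset.sum_ite_eq, implies_true, and_self, Finset.mem_filter, Fintype.mem_piFinset,
      Finset.mem_Icc, sum_fib_s15]
    congr 1
    simp only [eq_iff_iff, and_iff_right_iff_imp, and_imp]
    intro h2 _ i
    have h0 : ∀ i, 0 ≤ fib wt f i := fun i => Finset.sum_nonneg (fun x _ => by split_ifs <;> simp)
    refine ⟨h0 i, ?_⟩
    rw [← h2, ← sum_fib_s15 wt f]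
    exact Finset.single_le_sum (fun i _ => h0 i) (Finset.mem_univ i)
  · simp [h]

def Kc (p j : ℕ) : Set ℕ := {k | ordCompl[p] k = j}

lemma hh_univ_eq (p : ℕ) (m : ℕ) :
    hh Set.univ m = PW (fun j : Fin (m + 1) => Kc p j) m (fun _ => True) := by
  apply Phi_ext'
  intro n wt
  rw [Phi_hh, goodF_cvec, Phi_PW]
  by_cases h : (∑ x, (wt x : ℤ)) = m ∧ ∀ x, 0 < wt x
  · have hle : ∀ x, wt x ≤ m := by
      intro x
      have := Finset.single_le_sum (f := fun x => (wt x : ℤ)) (fun i _ => by simp) (Finset.mem_univ x)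
      simp only [h.1] at this
      exact_mod_cast this
    rw [if_pos ⟨h.1, fun x => ⟨trivial, h.2 x⟩⟩]
    rw [Finset.sum_eq_single (fun x => (⟨ordCompl[p] (wt x), by
      have := Nat.ordCompl_le (wt x) p
      have := hle x
      omega⟩ : Fin (m + 1)))]
    · rw [if_pos]
      exact ⟨fun x => ⟨rfl, h.2 x⟩, h.1, trivial⟩
    · intro f _ hf
      rw [if_neg]
      rintro ⟨h1, -⟩
      apply hf
      funext x
      apply Fin.ext
      exact (h1 x).1.symm
    · simp
  · rw [if_neg, Finset.sum_eq_zero]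
    · intro f _
      rw [if_neg]
      rintro ⟨h1, h2, -⟩
      exact h ⟨h2, fun x => (h1 x).2⟩
    · rintro ⟨h1, h2⟩
      exact h ⟨h1, fun x => (h2 x).2⟩

/-- number of subsets of weight `v` -/
def Fcnt {n : ℕ} (wt : Fin n → ℕ) (v : ℕ) : ℕ :=
  ∑ b : Fin n → Bool, if (∑ x, if b x then wt x else 0) = v then 1 else 0

lemma Fcnt_le {n : ℕ} (wt : Fin n → ℕ) (v : ℕ) : Fcnt wt v ≤ 2 ^ n := by
  unfold Fcnt
  calc _ ≤ ∑ b : Fin n → Bool, 1 := Finset.sum_le_sum (fun b _ => by split_ifs <;> simp)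
    _ = 2 ^ n := by simp

def QC (v k : ℕ) (W : (Fin k → Bool) → ℤ) : Prop :=
  ∀ r : Fin k, (∑ τ : Fin k → Bool, if τ r then W τ else 0) = v

lemma Phi_Q (K : Set ℕ) (m v k : ℕ) {n : ℕ} (wt : Fin n → ℕ) :
    Phi (cvec wt) (PW (fun _ : Fin k → Bool => K) m (QC v k)) =
      if goodF K m (cvec wt) then (Fcnt wt v : ℚ) ^ k else 0 := by
  rw [Phi_PW, goodF_cvec]
  split_ifs with h
  · have h1 : ∀ f : Fin n → Fin k → Bool, QC v k (fib wt f) ↔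
        ∀ r, (∑ x, if f x r then wt x else 0) = v := by
      intro f
      unfold QC fib
      apply forall_congr'
      intro r
      have : (∑ τ : Fin k → Bool, if τ r then ∑ x, (if f x = τ then (wt x : ℤ) else 0) else 0)
          = ((∑ x, if f x r then wt x else 0 : ℕ) : ℤ) := by
        push_cast
        have : ∀ τ : Fin k → Bool, (if τ r then ∑ x, (if f x = τ then (wt x : ℤ) else 0) else 0)
          = ∑ x, (if f x = τ then (if f x r then (wt x : ℤ) else 0) else 0) := by
          intro τ
          split_ifs with h
          · apply Finset.sum_congr rfl
            intro x _
            split_ifs with h2 h3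
            · rfl
            · subst h2; exact absurd h h3
            · rfl
          · symm; apply Finset.sum_eq_zero
            intro x _
            split_ifs with h2 h3
            · subst h2; exact absurd h3 h
            · rfl
            · rfl
        simp only [this]
        rw [Finset.sum_comm]
        simp
      rw [← Nat.cast_inj (R := ℤ), ← this]
      convert Iff.rfl
    simp only [h1, h.1, h.2, true_and, and_self, implies_true]
    rw [← (Equiv.piComm (fun (_ : Fin k) (_ : Fin n) => Bool)).sum_comp]
    unfold Fcnt
    push_cast
    rw [Fintype.sum_pow]
    apply Finset.sum_congr rfl
    intro g _
    rw [Finset.prod_ite_zero]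
    simp only [Equiv.piComm, Function.swap, Equiv.coe_fn_mk, Finset.mem_univ, true_implies, Finset.prod_const_one]
    congr
  · apply Finset.sum_eq_zero
    intro f _
    rw [if_neg]
    rintro ⟨h1, h2, -⟩
    exact h ⟨h2, h1⟩

open Polynomial in
lemma Fcnt_mod (p : ℕ) (hp : p.Prime) (j a u' : ℕ) (hj : 0 < j) {n : ℕ} (e : Fin n → ℕ)
    (hu : ∑ x, p ^ e x = p ^ a * u') :
    (Fcnt (fun x => j * p ^ e x) (j * p ^ a) : ZMod p) = u' := by
  have := Fact.mk hp
  have h1 : ∏ x, (1 + (X : (ZMod p)[X]) ^ (j * p ^ e x)) = (1 + X ^ (j * p ^ a)) ^ u' := by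
    have : ∀ i, (1 + (X : (ZMod p)[X]) ^ (j * p ^ i)) = (1 + X ^ j) ^ (p ^ i) := by
      intro i
      rw [add_pow_char_pow, one_pow, pow_mul]
    simp only [this]
    rw [Finset.prod_pow_eq_pow_sum, hu, pow_mul]
  have h2 : ∏ x, (1 + (X : (ZMod p)[X]) ^ (j * p ^ e x)) =
      ∑ b : Fin n → Bool, X ^ (∑ x, if b x then j * p ^ e x else 0) := by
    have : ∀ x, (1 + (X : (ZMod p)[X]) ^ (j * p ^ e x)) =
        ∑ b : Bool, X ^ (if b then j * p ^ e x else 0) := by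
      intro x; simp [add_comm]
    simp only [this]
    rw [Finset.prod_univ_sum]
    simp only [Fintype.piFinset_univ, Finset.prod_pow_eq_pow_sum]
  have h3 := congrArg (fun P => coeff P (j * p ^ a)) (h2.symm.trans h1)
  simp only [finsetSum_coeff, coeff_X_pow] at h3
  have h4 : (1 + (X : (ZMod p)[X]) ^ (j * p ^ a)) ^ u' = expand (ZMod p) (j * p ^ a) ((1 + X) ^ u') := by
    simp
  rw [h4] at h3
  have h5 := coeff_expand_mul (R := ZMod p) (p := j * p ^ a) (Nat.mul_pos hj (pow_pos hp.pos a))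
    ((1 + X) ^ u') 1
  rw [one_mul] at h5
  rw [h5, coeff_one_add_X_pow, Nat.choose_one_right] at h3
  rw [← h3]
  unfold Fcnt
  push_cast
  apply Finset.sum_congr rfl
  intro b _
  simp only [eq_comm]

def gen (p k : ℕ) : MvPowerSeries ℕ ℚ := hh (Kc p (ordCompl[p] k)) k

def SA (p : ℕ) (hp : p.Prime) : Subalgebra (Zploc p hp) (MvPowerSeries ℕ ℚ) :=
  Algebra.adjoin _ {P | ∃ k, 0 < k ∧ P = gen p k}

lemma hh_zero (K : Set ℕ) : hh K 0 = 1 := by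
  apply Phi_ext'
  intro n wt
  rw [Phi_hh, goodF_cvec, ← Finset.prod_empty (f := fun i : Fin 0 => hh K 0),
    ← Finset.univ_eq_empty, Phi_prod_hh]
  cases n with
  | zero => simp [mcond]
  | succ n =>
    rw [if_neg]
    · simp
    · rintro ⟨h1, h2⟩
      have := Finset.single_le_sum (f := fun x => (wt x : ℤ)) (fun i _ => by simp)
        (Finset.mem_univ 0)
      have h3 := (h2 0).2
      simp only [h1] at this
      omega

lemma zsmul_SA (p : ℕ) (hp : p.Prime) (P : MvPowerSeries ℕ ℚ) (D : ℕ) (hD : ¬ p ∣ D)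
    (h : (D : ℚ) • P ∈ SA p hp) : P ∈ SA p hp := by
  have hr : ((D : ℚ)⁻¹) ∈ Zploc p hp := ⟨1, D, by exact_mod_cast hD, by simp⟩
  have hD0 : (D : ℚ) ≠ 0 := by
    intro h0
    apply hD
    have : D = 0 := by exact_mod_cast h0
    simp [this]
  have := (SA p hp).smul_mem h ⟨_, hr⟩
  have h2 : (⟨(D : ℚ)⁻¹, hr⟩ : Zploc p hp) • ((D : ℚ) • P) = P := by
    change (D : ℚ)⁻¹ • ((D : ℚ) • P) = P
    rw [smul_smul, inv_mul_cancel₀ hD0, one_smul]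
  rwa [h2] at this

lemma PW_mem (p : ℕ) (hp : p.Prime) {I : Type*} [Fintype I] (K : I → Set ℕ) (m : ℕ)
    (C : (I → ℤ) → Prop)
    (h : ∀ W : I → ℤ, (∀ i, 0 ≤ W i) → ∑ i, W i = m → C W → ∀ i, hh (K i) (W i) ∈ SA p hp) :
    PW K m C ∈ SA p hp := by
  unfold PW
  apply Subalgebra.sum_mem
  intro W hW
  apply Subalgebra.prod_mem
  intro i _
  simp only [Finset.mem_filter, Fintype.mem_piFinset, Finset.mem_Icc] at hW
  exact h W (fun i => (hW.1 i).1) hW.2.1 hW.2.2 i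

open Polynomial in
lemma hh_step (p : ℕ) (hp : p.Prime) (K : Set ℕ) (m v : ℕ) (hv0 : 0 < v) (hvm : v < m)
    (ih : ∀ m' < m, hh K (m' : ℕ) ∈ SA p hp)
    (hF : ∀ (n : ℕ) (wt : Fin n → ℕ), goodF K m (cvec wt) → ¬ p ∣ Fcnt wt v) :
    hh K m ∈ SA p hp := by
  set T : Finset ℕ := (Finset.range (2 ^ m + 1)).filter (fun d => ¬ p ∣ d) with hT
  set P : ℤ[X] := ∏ d ∈ T, (C (d : ℤ) - X) with hP
  have hQ : ∀ k, PW (fun _ : Fin (k + 1) → Bool => K) m (QC v (k + 1)) ∈ SA p hp := by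
    intro k
    apply PW_mem
    intro W h0 hs hC τ
    obtain ⟨q, hq⟩ := Int.eq_ofNat_of_zero_le (h0 τ)
    rw [hq]
    apply ih
    have hC0 := hC 0
    by_cases hτ : τ 0
    · have := Finset.single_le_sum (f := fun τ : Fin (k + 1) → Bool => if τ 0 then W τ else 0)
        (fun i _ => by split_ifs; exacts [h0 i, le_rfl]) (Finset.mem_univ τ)
      simp only [hC0, hτ, if_true] at this
      omega
    · have h1 : (∑ τ : Fin (k + 1) → Bool, if τ 0 then 0 else W τ) = m - v := by
        rw [← hs, ← hC0, ← Finset.sum_sub_distrib]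
        apply Finset.sum_congr rfl
        intro x _
        split_ifs <;> simp
      have := Finset.single_le_sum (f := fun τ : Fin (k + 1) → Bool => if τ 0 then 0 else W τ)
        (fun i _ => by split_ifs; exacts [le_rfl, h0 i]) (Finset.mem_univ τ)
      simp only [h1, hτ] at this
      simp at this
      omega
  apply zsmul_SA p hp _ (∏ d ∈ T, d)
  · rw [hp.prime.dvd_finsetProd_iff]
    rintro ⟨d, hd, h⟩
    simp [hT] at hd
    exact hd.2 h
  · have key : ((∏ d ∈ T, d : ℕ) : ℚ) • hh K m =
        - ∑ k ∈ Finset.range P.natDegree, (P.coeff (k + 1)) •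
          PW (fun _ : Fin (k + 1) → Bool => K) m (QC v (k + 1)) := by
      apply Phi_ext'
      intro n wt
      rw [map_smul, map_neg, map_sum, Phi_hh]
      simp only [map_zsmul, Phi_Q]
      split_ifs with h
      · have hn : n ≤ m := by
          rw [goodF_cvec] at h
          have : ∑ x : Fin n, (1 : ℤ) ≤ ∑ x, (wt x : ℤ) :=
            Finset.sum_le_sum (fun x _ => by have := (h.2 x).2; omega)
          rw [h.1] at this
          simpa using this
        have hmem : Fcnt wt v ∈ T := by
          simp only [hT, Finset.mem_filter, Finset.mem_range]
          refine ⟨?_, hF n wt h⟩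
          have := Fcnt_le wt v
          have := Nat.pow_le_pow_right (n := 2) (by norm_num) hn
          omega
        have hz : P.eval (Fcnt wt v : ℤ) = 0 := by
          rw [hP, eval_prod]
          apply Finset.prod_eq_zero hmem
          simp
        rw [eval_eq_sum_range, Finset.sum_range_succ'] at hz
        have hc : P.coeff 0 = ∏ d ∈ T, (d : ℤ) := by
          rw [coeff_zero_eq_eval_zero, hP, eval_prod]
          simp
        rw [hc] at hz
        have hz' := congrArg (fun z : ℤ => (z : ℚ)) hz
        push_cast at hz'
        push_cast
        simp only [smul_eq_mul, mul_one, zsmul_eq_mul]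
        linarith
      · simp
    rw [key]
    apply Subalgebra.neg_mem
    apply Subalgebra.sum_mem
    intro k _
    exact Subalgebra.zsmul_mem _ (hQ k) _

lemma hh_Kc_mem (p : ℕ) (hp : p.Prime) (j : ℕ) : ∀ m : ℕ, hh (Kc p j) m ∈ SA p hp := by
  intro m
  induction m using Nat.strong_induction_on with
  | _ m ih =>
  by_cases hm : m = 0
  · subst hm
    rw [Nat.cast_zero, hh_zero]
    exact one_mem _
  by_cases hex : ∃ (n : ℕ) (wt : Fin n → ℕ), goodF (Kc p j) m (cvec wt)
  swap
  · have : hh (Kc p j) m = 0 := by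
      apply Phi_ext'
      intro n wt
      rw [Phi_hh, if_neg, map_zero]
      exact fun h => hex ⟨n, wt, h⟩
    rw [this]
    exact zero_mem _
  have hgood : ∀ (n : ℕ) (wt : Fin n → ℕ), goodF (Kc p j) m (cvec wt) →
      ∃ e : Fin n → ℕ, wt = (fun x => j * p ^ e x) ∧ m = j * ∑ x, p ^ e x := by
    intro n wt h
    rw [goodF_cvec] at h
    have hw : ∀ x, wt x = j * p ^ ((wt x).factorization p) := by
      intro x
      have h1 : ordCompl[p] (wt x) = j := (h.2 x).1
      have := Nat.ordProj_mul_ordCompl_eq_self (wt x) p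
      rw [h1] at this
      rw [mul_comm]; exact this.symm
    refine ⟨fun x => (wt x).factorization p, funext hw, ?_⟩
    have h1 : ∑ x, wt x = m := by exact_mod_cast h.1
    rw [← h1, Finset.mul_sum]
    exact Finset.sum_congr rfl (fun x _ => hw x)
  obtain ⟨n, wt, hg⟩ := hex
  obtain ⟨e, he, hme⟩ := hgood n wt hg
  have hj0 : 0 < j := by
    rcases Nat.eq_zero_or_pos j with h | h
    · simp [h] at hme; omega
    · exact h
  have hpj : ¬ p ∣ j := by
    rw [goodF_cvec] at hg
    cases n with
    | zero => simp at hme; omega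
    | succ n =>
      have h1 : ordCompl[p] (wt 0) = j := (hg.2 0).1
      rw [← h1]
      exact Nat.not_dvd_ordCompl hp (hg.2 0).2.ne'
  set u := ∑ x, p ^ e x with hu
  have hu0 : u ≠ 0 := by
    intro h
    rw [h] at hme; omega
  obtain ⟨a, u', hpu', hua⟩ := Nat.exists_eq_pow_mul_and_not_dvd hu0 p hp.ne_one
  by_cases h1 : u' = 1
  · rw [h1, mul_one] at hua
    rw [hua] at hme
    have : hh (Kc p j) m = gen p m := by
      unfold gen
      have : ordCompl[p] m = j := by
        rw [hme, mul_comm, Nat.ordCompl_mul, Nat.Prime.factorization_pow hp]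
        have h2 : j.factorization p = 0 := Nat.factorization_eq_zero_of_not_dvd hpj
        simp [h2, hp.pos]
      rw [this]
    rw [this]
    exact Algebra.subset_adjoin ⟨m, Nat.pos_of_ne_zero hm, rfl⟩
  have hu'0 : u' ≠ 0 := by
    rintro rfl
    simp at hpu'
  have hpa : 0 < p ^ a := pow_pos hp.pos a
  apply hh_step p hp _ m (j * p ^ a) (Nat.mul_pos hj0 hpa) _ ih
  · intro n' wt' hg'
    obtain ⟨e', he', hme'⟩ := hgood n' wt' hg'
    rw [he', ← ZMod.natCast_eq_zero_iff, Fcnt_mod p hp j a u' hj0 e', ZMod.natCast_eq_zero_iff]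
    · exact hpu'
    · rw [← hua]
      rw [hme] at hme'
      exact (Nat.eq_of_mul_eq_mul_left hj0 hme').symm
  · rw [hme, hua]
    apply Nat.mul_lt_mul_of_pos_left _ hj0
    have : 2 ≤ u' := by omega
    nlinarith

lemma hh_univ_mem (p : ℕ) (hp : p.Prime) (m : ℕ) : hh Set.univ m ∈ SA p hp := by
  rw [hh_univ_eq p m]
  apply PW_mem
  intro W h0 _ _ i
  obtain ⟨q, hq⟩ := Int.eq_ofNat_of_zero_le (h0 i)
  rw [hq]
  exact hh_Kc_mem p hp _ q

def wp (s : Multiset ℕ) : Fin (Multiset.card s) → ℕ := fun x => (s.sort (· ≤ ·)).getD x 0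

lemma map_wp (s : Multiset ℕ) : (Finset.univ : Finset (Fin (Multiset.card s))).val.map (wp s) = s := by
  have h : List.ofFn (wp s) = s.sort (· ≤ ·) := by
    apply List.ext_getElem
    · simp
    · intro i h1 h2
      simp [wp, List.getD_eq_getElem?_getD]
      simp at h2
      simp [h2]
  rw [Fin.univ_val_map, h, Multiset.sort_eq]

lemma wp_mem (s : Multiset ℕ) (x) : wp s x ∈ s := by
  have h : wp s x ∈ (Finset.univ : Finset (Fin (Multiset.card s))).val.map (wp s) :=
    Multiset.mem_map_of_mem _ (Finset.mem_univ x)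
  rwa [map_wp] at h

lemma sum_wp (s : Multiset ℕ) : ∑ x, wp s x = s.sum := by
  conv_rhs => rw [← map_wp s]
  rfl

lemma prod_wp {M : Type*} [CommMonoid M] (s : Multiset ℕ) (g : ℕ → M) :
    ∏ x, g (wp s x) = (s.map g).prod := by
  conv_rhs => rw [← map_wp s]
  rw [Multiset.map_map]
  rfl

def cok {J I : Type*} [Fintype J] (wt : J → ℕ) (W : I → ℕ) (f : J → I) : Prop :=
  ∀ i, (∑ x, if f x = i then wt x else 0) = W i

def cN {J I : Type*} [Fintype J] (wt : J → ℕ) (W : I → ℕ) : ℕ :=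
  Nat.card {f : J → I // cok wt W f}

lemma Mcount_eq (lam mu : Multiset ℕ) : Mcount lam mu = cN (wp mu) (wp lam) := by
  unfold Mcount cN
  rw [← Nat.card_eq_fintype_card]
  apply Nat.card_congr
  apply Equiv.subtypeEquivRight
  intro f
  unfold cok wp
  simp only [Finset.sum_filter]
  convert Iff.rfl

lemma cN_congr {J I J' I' : Type*} [Fintype J] [Fintype J'] (e : J ≃ J') (e' : I ≃ I')
    (wt : J' → ℕ) (W : I' → ℕ) : cN (wt ∘ e) (W ∘ e') = cN wt W := by
  unfold cN
  apply Nat.card_congr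
  refine (e.arrowCongr e').subtypeEquiv ?_
  intro f
  unfold cok
  rw [← e'.forall_congr_right]
  apply forall_congr'
  intro i
  rw [← e.sum_comp]
  simp [Equiv.arrowCongr]

lemma exists_equiv {J J' : Type*} [Fintype J] [Fintype J'] (wt : J → ℕ) (wt' : J' → ℕ)
    (h : (Finset.univ : Finset J).val.map wt = (Finset.univ : Finset J').val.map wt') :
    ∃ e : J ≃ J', wt = wt' ∘ e := by
  have hc : ∀ k, Nonempty ({x // wt x = k} ≃ {x // wt' x = k}) := by
    intro k
    rw [← Fintype.card_eq, Fintype.card_subtype, Fintype.card_subtype]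
    have := congrArg (Multiset.count k) h
    rw [Multiset.count_map, Multiset.count_map] at this
    simpa [Finset.card_def, eq_comm] using this
  refine ⟨Equiv.ofFiberEquiv (fun k => Classical.choice (hc k)), ?_⟩
  funext x
  exact (Equiv.ofFiberEquiv_map _ x).symm

lemma Mcount_eq' {J I : Type*} [Fintype J] [Fintype I] (wt : J → ℕ) (W : I → ℕ) :
    Mcount ((Finset.univ : Finset I).val.map W) ((Finset.univ : Finset J).val.map wt) = cN wt W := by
  rw [Mcount_eq]
  obtain ⟨e, he⟩ := exists_equiv wt (wp ((Finset.univ : Finset J).val.map wt)) (map_wp _).symm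
  obtain ⟨e', he'⟩ := exists_equiv W (wp ((Finset.univ : Finset I).val.map W)) (map_wp _).symm
  conv_rhs => rw [he, he']
  rw [cN_congr]

lemma cok_sum {J I : Type*} [Fintype J] [Fintype I] {wt : J → ℕ} {W : I → ℕ} {f : J → I}
    (h : cok wt W f) : ∑ x, wt x = ∑ i, W i := by
  simp only [← h _]
  rw [Finset.sum_comm]
  simp

lemma Mcount_sum {lam mu : Multiset ℕ} (h : Mcount lam mu ≠ 0) : mu.sum = lam.sum := by
  rw [Mcount_eq] at h
  obtain ⟨⟨f, hf⟩⟩ := (Nat.card_ne_zero.mp h).1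
  rw [← sum_wp, ← sum_wp]
  exact cok_sum hf

lemma fiber_key {J I T : Type*} [Fintype J] (cJ : J → T) (cI : I → T) (d : T → ℕ)
    (a : J → ℕ) (f : J → I) (hf : ∀ x, cI (f x) = cJ x) (i : I) :
    (∑ x, if f x = i then d (cJ x) * a x else 0) =
      d (cI i) * ∑ x : {x // cJ x = cI i}, if f x.1 = i then a x.1 else 0 := by
  rw [Finset.mul_sum]
  rw [← Finset.sum_subtype (Finset.univ.filter (fun x => cJ x = cI i)) (by simp)
    (fun x => d (cI i) * if f x = i then a x else 0), Finset.sum_filter]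
  apply Finset.sum_congr rfl
  intro x _
  by_cases h : f x = i
  · have : cJ x = cI i := by rw [← hf x, h]
    simp [h, this]
  · simp [h]

lemma prod_cN {J I T : Type*} [Fintype J] [Fintype I] [Fintype T] (cJ : J → T) (cI : I → T)
    (d : T → ℕ) (hd : ∀ t, 0 < d t) (a : J → ℕ) (b : I → ℕ) :
    Nat.card {f : J → I // (∀ x, cI (f x) = cJ x) ∧
      cok (fun x => d (cJ x) * a x) (fun i => d (cI i) * b i) f} =
    ∏ t, cN (fun x : {x // cJ x = t} => a x.1) (fun i : {i // cI i = t} => b i.1) := by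
  unfold cN
  rw [← Nat.card_pi]
  have key : ∀ f : J → I, ∀ hf : (∀ x, cI (f x) = cJ x),
      cok (fun x => d (cJ x) * a x) (fun i => d (cI i) * b i) f ↔
      ∀ t, cok (fun x : {x // cJ x = t} => a x.1) (fun i : {i // cI i = t} => b i.1)
        (fun x => ⟨f x.1, (hf x.1).trans x.2⟩) := by
    intro f hf
    unfold cok
    constructor
    · rintro h t ⟨i, rfl⟩
      have := h i
      rw [fiber_key cJ cI d a f hf i] at this
      simpa using Nat.eq_of_mul_eq_mul_left (hd _) this
    · intro h i
      rw [fiber_key cJ cI d a f hf i]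
      have := h (cI i) ⟨i, rfl⟩
      simp only [Subtype.mk.injEq] at this
      rw [this]
  apply Nat.card_congr
  refine ⟨fun f t => ⟨fun x => ⟨f.1 x.1, (f.2.1 x.1).trans x.2⟩, (key f.1 f.2.1).1 f.2.2 t⟩,
    fun g => ⟨fun x => ((g (cJ x)).1 ⟨x, rfl⟩).1, ?_, ?_⟩, ?_, ?_⟩
  · exact fun x => ((g (cJ x)).1 ⟨x, rfl⟩).2
  · rw [key _ (fun x => ((g (cJ x)).1 ⟨x, rfl⟩).2)]
    intro t
    convert (g t).2 using 1
    funext x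
    obtain ⟨x, rfl⟩ := x
    rfl
  · intro f; rfl
  · intro g
    funext t
    apply Subtype.ext
    funext x
    obtain ⟨x, rfl⟩ := x
    rfl

lemma ordCompl_mul_pow (p : ℕ) (hp : p.Prime) (j n : ℕ) (hj : ¬ p ∣ j) :
    ordCompl[p] (j * p ^ n) = j := by
  have h2 : j.factorization p = 0 := Nat.factorization_eq_zero_of_not_dvd hj
  rw [mul_comm, Nat.ordCompl_mul, Nat.Prime.factorization_pow hp]
  simp [h2, hp.pos]

lemma eq_ordCompl_mul (p a j : ℕ) (h : ordCompl[p] a = j) : a = j * p ^ (a.factorization p) := by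
  have := Nat.ordProj_mul_ordCompl_eq_self a p
  rw [h] at this
  rw [mul_comm]; exact this.symm

lemma iotaM_eq (p : ℕ) (hp : p.Prime) (w j : ℕ) (hj : ¬ p ∣ j) (s : Multiset ℕ)
    (hs : ∀ a ∈ s, 0 < a ∧ a ≤ w) :
    iotaM p w s j = (s.filter (fun a => ordCompl[p] a = j)).map (fun a => a / j) := by
  have hj0 : 0 < j := Nat.pos_of_ne_zero (by rintro rfl; simp at hj)
  induction s using Multiset.induction_on with
  | empty => simp [iotaM]
  | cons a s ih =>
    have ih' := ih (fun b hb => hs b (Multiset.mem_cons_of_mem hb))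
    have ha := hs a (Multiset.mem_cons_self a s)
    have h1 : iotaM p w (a ::ₘ s) j = iotaM p w s j +
        ∑ n ∈ Finset.range (w + 1), Multiset.replicate (if j * p ^ n = a then 1 else 0) (p ^ n) := by
      unfold iotaM
      rw [← Finset.sum_add_distrib]
      apply Finset.sum_congr rfl
      intro n _
      rw [Multiset.count_cons, Multiset.replicate_add]
    rw [h1, ih', Multiset.filter_cons, Multiset.map_add, add_comm]
    congr 1
    split_ifs with h
    · have hae := eq_ordCompl_mul p a j h
      rw [Finset.sum_eq_single (a.factorization p)]
      · rw [if_pos hae.symm, Multiset.replicate_one, Multiset.map_singleton]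
        congr 1
        conv_rhs => rw [hae]
        rw [Nat.mul_div_cancel_left _ hj0]
      · intro n _ hn
        rw [if_neg, Multiset.replicate_zero]
        intro h3
        apply hn
        rw [hae] at h3
        have := Nat.eq_of_mul_eq_mul_left hj0 h3
        exact Nat.pow_right_injective hp.two_le this
      · intro h3
        exfalso
        apply h3
        rw [Finset.mem_range]
        have := Nat.factorization_lt p ha.1.ne'
        omega
    · rw [Multiset.map_zero]
      apply Finset.sum_eq_zero
      intro n _
      rw [if_neg, Multiset.replicate_zero]
      rintro rfl
      exact h (ordCompl_mul_pow p hp j n hj)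

lemma wsum_eq (p : ℕ) (hp : p.Prime) (w j : ℕ) (hj : ¬ p ∣ j) (s : Multiset ℕ)
    (hs : ∀ a ∈ s, a ≤ w) : wsum p j s = (iotaM p w s j).sum := by
  have hj0 : 0 < j := Nat.pos_of_ne_zero (by rintro rfl; simp at hj)
  unfold wsum iotaM
  rw [finsum_eq_sum_of_support_subset (s := Finset.range (w + 1))]
  · have : ∀ (t : Finset ℕ) (g : ℕ → Multiset ℕ), (∑ n ∈ t, g n).sum = ∑ n ∈ t, (g n).sum :=
      fun t g => map_sum (Multiset.sumAddMonoidHom : Multiset ℕ →+ ℕ) g t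
    rw [this]
    simp
  · intro n hn
    rw [Function.mem_support] at hn
    simp only [Finset.coe_range, Set.mem_Iio]
    by_contra hlt
    apply hn
    rw [Multiset.count_eq_zero_of_notMem, zero_mul]
    intro hmem
    have h1 := hs _ hmem
    have h2 : n < p ^ n := Nat.lt_pow_self hp.one_lt
    nlinarith

lemma wsum_big (p : ℕ) (hp : p.Prime) (w j : ℕ) (hj : w < j) (s : Multiset ℕ)
    (hs : ∀ a ∈ s, a ≤ w) : wsum p j s = 0 := by
  unfold wsum
  have : ∀ n, Multiset.count (j * p ^ n) s * p ^ n = 0 := by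
    intro n
    rw [Multiset.count_eq_zero_of_notMem, zero_mul]
    intro hmem
    have h1 := hs _ hmem
    have h2 : 0 < p ^ n := pow_pos hp.pos n
    nlinarith
  simp [this]

/-- number of class preserving maps -/
def Lcnt (p : ℕ) (lam mu : Multiset ℕ) : ℕ :=
  Nat.card {f : Fin (Multiset.card mu) → Fin (Multiset.card lam) //
    (∀ x, ordCompl[p] (wp lam (f x)) = ordCompl[p] (wp mu x)) ∧ cok (wp mu) (wp lam) f}

lemma map_subtype_univ {J : Type*} [Fintype J] (P : J → Prop) [inst : Fintype {x // P x}]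
    (g : J → ℕ) :
    (Finset.univ : Finset {x // P x}).val.map (fun x => g x.1) =
      ((Finset.univ : Finset J).val.filter P).map g := by
  obtain rfl : inst = Subtype.fintype P := Subsingleton.elim _ _
  have := congrArg Finset.val (Finset.subtype_map P (s := (Finset.univ : Finset J)))
  rw [Finset.map_val, Finset.filter_val] at this
  rw [← this, Multiset.map_map]
  simp [Function.comp_def]

lemma parts_bd {w : ℕ} (lam : Nat.Partition w) : ∀ a ∈ lam.parts, 0 < a ∧ a ≤ w :=
  fun _ ha => ⟨lam.parts_pos ha, Nat.Partition.le_of_mem_parts ha⟩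

lemma iota_wp (p : ℕ) (hp : p.Prime) (w j : ℕ) (hj : ¬ p ∣ j) (s : Multiset ℕ)
    (hs : ∀ a ∈ s, 0 < a ∧ a ≤ w) :
    iotaM p w s j = (Finset.univ : Finset {x // ordCompl[p] (wp s x) = j}).val.map
      (fun x => wp s x.1 / j) := by
  rw [iotaM_eq p hp w j hj s hs, map_subtype_univ (fun x => ordCompl[p] (wp s x) = j)
    (fun x => wp s x / j)]
  conv_lhs => rw [← map_wp s]
  rw [Multiset.filter_map, Multiset.map_map]
  congr!

lemma Lmat_eq (p : ℕ) (hp : p.Prime) (w : ℕ) (lam mu : Nat.Partition w) :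
    Lmat p w lam mu = (Lcnt p lam.parts mu.parts : ℚ) := by
  set TT := (Finset.range (w + 1)).filter (fun j => ¬ p ∣ j) with hTT
  have h1 : Lmat p w lam mu = ∏ j ∈ TT,
      (Mcount (iotaM p w lam.parts j) (iotaM p w mu.parts j) : ℚ) := by
    simp only [Lmat, Matrix.of_apply]
    split_ifs with h
    · rfl
    · unfold samePBlock at h
      push Not at h
      obtain ⟨j, hj, hne⟩ := h
      symm
      have hjw : j ≤ w := by
        by_contra hlt
        apply hne
        rw [wsum_big p hp w j (by omega) _ (fun a ha => (parts_bd lam a ha).2),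
          wsum_big p hp w j (by omega) _ (fun a ha => (parts_bd mu a ha).2)]
      apply Finset.prod_eq_zero (i := j)
      · simp [hTT, hj]; omega
      · rw [Nat.cast_eq_zero]
        by_contra hM
        apply hne
        rw [wsum_eq p hp w j hj _ (fun a ha => (parts_bd lam a ha).2),
          wsum_eq p hp w j hj _ (fun a ha => (parts_bd mu a ha).2)]
        exact (Mcount_sum hM).symm
  rw [h1, ← Finset.prod_coe_sort, ← Nat.cast_prod, Nat.cast_inj]
  have hcls : ∀ (nu : Nat.Partition w) (x), ordCompl[p] (wp nu.parts x) ∈ TT := by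
    intro nu x
    have h2 := parts_bd nu _ (wp_mem nu.parts x)
    simp only [hTT, Finset.mem_filter, Finset.mem_range]
    refine ⟨?_, Nat.not_dvd_ordCompl hp h2.1.ne'⟩
    have := Nat.ordCompl_le (wp nu.parts x) p
    omega
  have hdec : ∀ (nu : Nat.Partition w) (x), wp nu.parts x =
      ordCompl[p] (wp nu.parts x) * (wp nu.parts x / ordCompl[p] (wp nu.parts x)) := by
    intro nu x
    rw [Nat.mul_div_cancel' (Nat.ordCompl_dvd _ _)]
  have := prod_cN (T := TT) (fun x => ⟨_, hcls mu x⟩) (fun x => ⟨_, hcls lam x⟩) (fun t => t.1)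
    (fun t => Nat.pos_of_ne_zero (by
      intro h0
      have h3 := t.2
      simp only [h0, hTT, Finset.mem_filter] at h3
      exact h3.2 (dvd_zero p)))
    (fun x => wp mu.parts x / ordCompl[p] (wp mu.parts x))
    (fun x => wp lam.parts x / ordCompl[p] (wp lam.parts x))
  simp only [← hdec, Subtype.mk.injEq] at this
  unfold Lcnt
  rw [this]
  apply Finset.prod_congr rfl
  rintro ⟨j, hj⟩ _
  have hjp : ¬ p ∣ j := by
    simp only [hTT, Finset.mem_filter] at hj
    exact hj.2
  rw [iota_wp p hp w j hjp _ (parts_bd mu), iota_wp p hp w j hjp _ (parts_bd lam), Mcount_eq']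
  have e1 : (fun x : {x // ordCompl[p] (wp mu.parts x) = j} => wp mu.parts x.1 / j) =
    fun x : {x // ordCompl[p] (wp mu.parts x) = j} =>
      wp mu.parts x.1 / ordCompl[p] (wp mu.parts x.1) := by
    funext x; rw [x.2]
  have e2 : (fun x : {x // ordCompl[p] (wp lam.parts x) = j} => wp lam.parts x.1 / j) =
    fun x : {x // ordCompl[p] (wp lam.parts x) = j} =>
      wp lam.parts x.1 / ordCompl[p] (wp lam.parts x.1) := by
    funext x; rw [x.2]
  rw [e1, e2]
  convert rfl <;> simp

lemma cok_cast {J I : Type*} [Fintype J] (wt : J → ℕ) (W : I → ℕ) (f : J → I) :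
    cok wt W f ↔ ∀ i, (∑ x, if f x = i then (wt x : ℤ) else 0) = (W i : ℤ) := by
  unfold cok
  apply forall_congr'
  intro i
  rw [← Nat.cast_inj (R := ℤ)]
  push_cast
  rfl

lemma sum_ite_card {A : Type*} [Fintype A] (P : A → Prop) :
    (∑ f : A, if P f then (1 : ℚ) else 0) = (Nat.card {f // P f} : ℚ) := by
  rw [Nat.card_eq_fintype_card, Fintype.card_subtype]
  simp

lemma Mmat_Phi (w : ℕ) (lam mu : Nat.Partition w) :
    Mmat w lam mu = Phi (cvec (wp mu.parts)) (∏ i, hh Set.univ (wp lam.parts i : ℕ)) := by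
  rw [Phi_prod_hh (fun _ => Set.univ) _ _ (fun i => ((wp lam.parts i : ℕ) : ℤ)), sum_ite_card]
  simp only [Mmat, Matrix.of_apply]
  rw [Mcount_eq]
  unfold cN
  congr 1
  apply Nat.card_congr
  apply Equiv.subtypeEquivRight
  intro f
  rw [cok_cast]
  unfold mcond
  constructor
  · exact fun h => ⟨fun x => ⟨trivial, mu.parts_pos (wp_mem _ x)⟩, h⟩
  · exact fun h => h.2

lemma Phi_gen (p : ℕ) (s : Multiset ℕ) (mu : Multiset ℕ) (hmu : ∀ a ∈ mu, 0 < a) :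
    Phi (cvec (wp mu)) ((s.map (gen p)).prod) = (Lcnt p s mu : ℚ) := by
  rw [← prod_wp]
  unfold gen
  rw [Phi_prod_hh (fun i => Kc p (ordCompl[p] (wp s i))) _ _ (fun i => ((wp s i : ℕ) : ℤ)),
    sum_ite_card]
  unfold Lcnt
  congr 1
  apply Nat.card_congr
  apply Equiv.subtypeEquivRight
  intro f
  rw [cok_cast]
  unfold mcond
  constructor
  · exact fun h => ⟨fun x => (h.1 x).1.symm, h.2⟩
  · exact fun h => ⟨fun x => ⟨(h.1 x).symm, hmu _ (wp_mem _ x)⟩, h.2⟩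

lemma Lcnt_sum {p : ℕ} {lam mu : Multiset ℕ} (h : Lcnt p lam mu ≠ 0) : mu.sum = lam.sum := by
  obtain ⟨⟨f, hf⟩⟩ := (Nat.card_ne_zero.mp h).1
  rw [← sum_wp, ← sum_wp]
  exact cok_sum hf.2

lemma SA_expand (p : ℕ) (hp : p.Prime) (w : ℕ) (P : MvPowerSeries ℕ ℚ) (hP : P ∈ SA p hp) :
    ∃ v : Nat.Partition w → Zploc p hp, ∀ mu : Nat.Partition w,
      Phi (cvec (wp mu.parts)) P = ∑ κ, (v κ : ℚ) * Lmat p w κ mu := by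
  have hP' : P ∈ Subalgebra.toSubmodule (SA p hp) := hP
  clear hP
  unfold SA at hP'
  rw [Algebra.adjoin_eq_span] at hP'
  induction hP' using Submodule.span_induction with
  | mem P h =>
    have : ∃ s : Multiset ℕ, (∀ k ∈ s, 0 < k) ∧ P = (s.map (gen p)).prod := by
      induction h using Submonoid.closure_induction with
      | mem x hx =>
        obtain ⟨k, hk, rfl⟩ := hx
        exact ⟨{k}, by simpa using hk, by simp⟩
      | one => exact ⟨0, by simp, by simp⟩
      | mul x y _ _ hx hy =>
        obtain ⟨s, hs, rfl⟩ := hx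
        obtain ⟨t, ht, rfl⟩ := hy
        refine ⟨s + t, ?_, by simp⟩
        intro k hk
        rcases Multiset.mem_add.mp hk with h | h
        exacts [hs k h, ht k h]
    obtain ⟨s, hs, rfl⟩ := this
    by_cases hsum : s.sum = w
    · refine ⟨fun κ => if κ = ⟨s, fun h => hs _ h, hsum⟩ then 1 else 0, fun mu => ?_⟩
      rw [Phi_gen p s _ (fun a ha => mu.parts_pos ha),
        Finset.sum_eq_single ⟨s, fun h => hs _ h, hsum⟩]
      · simp [Lmat_eq p hp]
      · intro b _ hb
        simp [hb]
      · simp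
    · refine ⟨fun _ => 0, fun mu => ?_⟩
      rw [Phi_gen p s _ (fun a ha => mu.parts_pos ha)]
      simp only [ZeroMemClass.coe_zero, zero_mul, Finset.sum_const_zero, Nat.cast_eq_zero]
      by_contra h
      have := Lcnt_sum h
      rw [mu.parts_sum] at this
      exact hsum this.symm
  | zero => exact ⟨fun _ => 0, fun mu => by simp⟩
  | add x y hx hy ihx ihy =>
    obtain ⟨v, hv⟩ := ihx
    obtain ⟨v', hv'⟩ := ihy
    refine ⟨fun κ => v κ + v' κ, fun mu => ?_⟩
    rw [map_add, hv, hv', ← Finset.sum_add_distrib]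
    apply Finset.sum_congr rfl
    intro κ _
    push_cast
    ring
  | smul a x hx ihx =>
    obtain ⟨v, hv⟩ := ihx
    refine ⟨fun κ => a * v κ, fun mu => ?_⟩
    have : a • x = (a : ℚ) • x := rfl
    rw [this, map_smul, hv, smul_eq_mul, Finset.mul_sum]
    apply Finset.sum_congr rfl
    intro κ _
    push_cast
    ring

lemma cok_surj {J I : Type*} [Fintype J] {wt : J → ℕ} {W : I → ℕ} {f : J → I}
    (hW : ∀ i, 0 < W i) (h : cok wt W f) : Function.Surjective f := by
  intro i
  by_contra hne
  push Not at hne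
  have := h i
  rw [Finset.sum_eq_zero (fun x _ => by rw [if_neg (hne x)])] at this
  have := hW i
  omega

lemma cok_inj {J I : Type*} [Fintype J] {wt : J → ℕ} {W : I → ℕ} {f : J → I}
    (h : cok wt W f) (hf : Function.Injective f) (x : J) : wt x = W (f x) := by
  rw [← h (f x), Finset.sum_eq_single x]
  · simp
  · intro y _ hy
    rw [if_neg (fun h' => hy (hf h'))]
  · simp

lemma wp_pos {w : ℕ} (lam : Nat.Partition w) (x) : 0 < wp lam.parts x :=
  lam.parts_pos (wp_mem _ x)

lemma Mmat_tri (w : ℕ) (lam mu : Nat.Partition w) (h : Mmat w lam mu ≠ 0) :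
    lam = mu ∨ Multiset.card lam.parts < Multiset.card mu.parts := by
  simp only [Mmat, Matrix.of_apply, Mcount_eq] at h
  rw [Nat.cast_ne_zero] at h
  obtain ⟨⟨f, hf⟩⟩ := (Nat.card_ne_zero.mp h).1
  have hs := cok_surj (wp_pos lam) hf
  have hle := Fintype.card_le_of_surjective f hs
  simp only [Fintype.card_fin] at hle
  rcases hle.lt_or_eq with h1 | h1
  · exact Or.inr h1
  · left
    have hb : Function.Bijective f :=
      (Fintype.bijective_iff_surjective_and_card f).mpr ⟨hs, by simp [h1]⟩
    apply Nat.Partition.ext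
    rw [← map_wp mu.parts, ← map_wp lam.parts]
    have : wp mu.parts = wp lam.parts ∘ (Equiv.ofBijective f hb) := by
      funext x
      exact cok_inj hf hb.1 x
    rw [this, ← Multiset.map_map, Multiset.map_univ_val_equiv]

lemma Lmat_tri (p : ℕ) (hp : p.Prime) (w : ℕ) (lam mu : Nat.Partition w) (h : Lmat p w lam mu ≠ 0) :
    Mmat w lam mu ≠ 0 := by
  rw [Lmat_eq p hp, Nat.cast_ne_zero] at h
  simp only [Mmat, Matrix.of_apply, Mcount_eq]
  rw [Nat.cast_ne_zero]
  obtain ⟨⟨f, hf⟩⟩ := (Nat.card_ne_zero.mp h).1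
  exact Nat.card_ne_zero.mpr ⟨⟨⟨f, hf.2⟩⟩, inferInstance⟩

lemma diag_eq (p : ℕ) (hp : p.Prime) (w : ℕ) (lam : Nat.Partition w) :
    Lmat p w lam lam = Mmat w lam lam := by
  rw [Lmat_eq p hp]
  simp only [Mmat, Matrix.of_apply, Mcount_eq]
  unfold Lcnt cN
  congr 1
  apply Nat.card_congr
  apply Equiv.subtypeEquivRight
  intro f
  refine ⟨fun h => h.2, fun h => ⟨fun x => ?_, h⟩⟩
  have hs := cok_surj (wp_pos lam) h
  rw [cok_inj h (Finite.injective_iff_surjective.mpr hs) x]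

lemma diag_ne (w : ℕ) (lam : Nat.Partition w) : Mmat w lam lam ≠ 0 := by
  simp only [Mmat, Matrix.of_apply, Mcount_eq]
  rw [Nat.cast_ne_zero]
  exact Nat.card_ne_zero.mpr ⟨⟨⟨id, fun i => by
    simp only [id]
    rw [Finset.sum_eq_single i]
    · simp
    · intro y _ hy
      rw [if_neg hy]
    · simp⟩⟩, inferInstance⟩

lemma det_tri {A : Type*} [Fintype A] [DecidableEq A] (M : Matrix A A ℚ) (b : A → ℕ)
    (h : ∀ i j, M i j ≠ 0 → i = j ∨ b i < b j) : M.det = ∏ i, M i i := by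
  rw [Matrix.det_apply, Finset.sum_eq_single (1 : Equiv.Perm A)]
  · simp
  · intro σ _ hσ
    by_contra hne
    have h1 : ∀ i, M (σ i) i ≠ 0 := by
      intro i h0
      apply hne
      rw [Finset.prod_eq_zero (f := fun i => M (σ i) i) (Finset.mem_univ i) h0, smul_zero]
    apply hσ
    ext i
    by_contra hi
    have hlt : ∑ i, b (σ i) < ∑ i, b i := by
      apply Finset.sum_lt_sum
      · intro j _
        rcases h _ _ (h1 j) with h2 | h2
        · rw [h2]
        · exact h2.le
      · exact ⟨i, Finset.mem_univ i, (h _ _ (h1 i)).resolve_left hi⟩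
    rw [Equiv.sum_comp σ b] at hlt
    exact lt_irrefl _ hlt
  · simp

/-- **Lemma 4.7.** The matrices `M = M(h, p̃; w)` and `L` are row equivalent over `ℤ_(p)`. -/
theorem M_rowequiv_L (p : ℕ) (hp : p.Prime) (w : ℕ) :
    ∃ U : Matrix (Nat.Partition w) (Nat.Partition w) (Zploc p hp),
      IsUnit U ∧ Lmat p w = U.map (fun x => (x : ℚ)) * Mmat w := by
  have hV : ∀ lam : Nat.Partition w, ∃ v : Nat.Partition w → Zploc p hp,
      ∀ mu : Nat.Partition w, Mmat w lam mu = ∑ κ, (v κ : ℚ) * Lmat p w κ mu := by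
    intro lam
    obtain ⟨v, hv⟩ := SA_expand p hp w (∏ i, hh Set.univ (wp lam.parts i : ℕ))
      (Subalgebra.prod_mem _ (fun i _ => hh_univ_mem p hp _))
    exact ⟨v, fun mu => by rw [Mmat_Phi, hv]⟩
  choose V hV using hV
  set VM : Matrix (Nat.Partition w) (Nat.Partition w) (Zploc p hp) := Matrix.of V with hVM
  have hmul : Mmat w = VM.map (Zploc p hp).subtype * Lmat p w := by
    ext lam mu
    rw [hV, Matrix.mul_apply]
    rfl
  have hdM := det_tri (Mmat w) (fun lam => Multiset.card lam.parts) (Mmat_tri w)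
  have hdL := det_tri (Lmat p w) (fun lam => Multiset.card lam.parts)
    (fun i j h => Mmat_tri w i j (Lmat_tri p hp w i j h))
  have hLM : (Lmat p w).det = (Mmat w).det := by
    rw [hdM, hdL]
    exact Finset.prod_congr rfl (fun i _ => diag_eq p hp w i)
  have hne : (Mmat w).det ≠ 0 := by
    rw [hdM, Finset.prod_ne_zero_iff]
    exact fun i _ => diag_ne w i
  have hdet : VM.det = 1 := by
    have h1 := congrArg Matrix.det hmul
    rw [Matrix.det_mul, hLM] at h1
    have h2 : (VM.map (Zploc p hp).subtype).det = 1 :=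
      mul_right_cancel₀ hne (by rw [one_mul]; exact h1.symm)
    have h3 : (Zploc p hp).subtype VM.det = 1 := by
      rw [RingHom.map_det]; exact h2
    exact Subtype.ext h3
  have hU : IsUnit VM := by
    rw [Matrix.isUnit_iff_isUnit_det, hdet]
    exact isUnit_one
  have hu : IsUnit VM.det := by rw [hdet]; exact isUnit_one
  refine ⟨VM⁻¹, Matrix.isUnit_nonsing_inv_iff.mpr hU, ?_⟩
  change Lmat p w = (VM⁻¹).map (Zploc p hp).subtype * Mmat w
  rw [hmul, ← Matrix.mul_assoc, ← Matrix.map_mul, Matrix.nonsing_inv_mul _ hu]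
  simp

end
end

section
/- Fix a prime p, r ≥ 0, and w ≥ 0. Let N be the Pow(w)×Pow(w)-matrix with N_{λμ} = |𝓜_{λμ}|, and let b be the diagonal Pow(w)×Pow(w)-matrix with b_λ = p^{r·l(λ)}. Then Y = N b N^{-1} is equivalent over ℤ_(p) to the diagonal matrix with diagonal entries p^{c_{p,r}(λ)}, λ ∈ Pow(w); i.e., the elementary divisors of Y are p^{c_{p,r}(λ)}, λ ∈ Pow(w). -/
open scoped BigOperators
open Classical

noncomputable section

/-- `d_p(k) = v_p(k!)`. -/
def dval (p k : ℕ) : ℕ := padicValNat p (Nat.factorial k)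

/-- `c_{p,r}(λ) = ∑_{j ≥ 1, v_p(j) < r} ((r - v_p(j)) m_j(λ) + d_p(m_j(λ)))`. -/
def cpr (p r : ℕ) (lam : Multiset ℕ) : ℕ :=
  ∑ j ∈ lam.toFinset.filter (fun j => padicValNat p j < r),
    ((r - padicValNat p j) * lam.count j + dval p (lam.count j))

/-- `ϑ_λ(ℓ) = ∏_{p^r ∥ ℓ} p^{c_{p,r}(λ)}`, with `ϑ_λ(0) = 0`. -/
def theta (lam : Multiset ℕ) (l : ℕ) : ℚ :=
  if l = 0 then 0 else ∏ q ∈ l.primeFactors, (q : ℚ) ^ cpr q (padicValNat q l) lam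

/-- `Pow(w)`: the partitions of `w` all of whose parts are powers of `p` (including `p^0 = 1`). -/
abbrev PowP (p w : ℕ) : Type := {lam : Nat.Partition w // ∀ j ∈ lam.parts, ∃ n : ℕ, j = p ^ n}

/-- The matrix `N = N^{(w)}` on `Pow(w)`: `N_{λμ} = |𝓜_{λμ}|`. -/
def Nmat (p w : ℕ) : Matrix (PowP p w) (PowP p w) ℚ :=
  Matrix.of fun lam mu => (Mcount lam.1.parts mu.1.parts : ℚ)

/-! ### Part 1: Witt vector polynomials -/

namespace YED

open MvPolynomial

/-- The ring endomorphism of `ℤ[a₀, a₁, …]` which is multiplication by `p ^ r` on Witt vectors. -/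
def psi (p r : ℕ) [Fact p.Prime] : MvPolynomial ℕ ℤ →ₐ[ℤ] MvPolynomial ℕ ℤ :=
  bind₁ (WittVector.wittMulN p (p ^ r))

/-- The Frobenius lift on `ℤ[a₀, a₁, …]`. -/
def phi (p : ℕ) [Fact p.Prime] : MvPolynomial ℕ ℤ →ₐ[ℤ] MvPolynomial ℕ ℤ :=
  bind₁ (WittVector.frobeniusPoly p)

lemma psi_witt (p r n : ℕ) [Fact p.Prime] :
    psi p r (wittPolynomial p ℤ n) = (p : MvPolynomial ℕ ℤ) ^ r * wittPolynomial p ℤ n := by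
  unfold psi
  rw [WittVector.bind₁_wittMulN_wittPolynomial]
  push_cast
  rfl

lemma phi_witt (p n : ℕ) [Fact p.Prime] :
    phi p (wittPolynomial p ℤ n) = wittPolynomial p ℤ (n + 1) :=
  WittVector.bind₁_frobeniusPoly_wittPolynomial p n

lemma psi_phi (p r : ℕ) [Fact p.Prime] (x : MvPolynomial ℕ ℤ) :
    psi p r (phi p x) = phi p (psi p r x) := by
  have key : (fun n => psi p r (phi p (X n))) = fun n => phi p (psi p r (X n)) := by
    apply WittVector.poly_eq_of_wittPolynomial_bind_eq p
    intro n
    have h1 : (bind₁ fun n => psi p r (phi p (X n))) = (psi p r).comp (phi p) := by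
      apply MvPolynomial.algHom_ext
      intro i
      simp
    have h2 : (bind₁ fun n => phi p (psi p r (X n))) = (phi p).comp (psi p r) := by
      apply MvPolynomial.algHom_ext
      intro i
      simp
    rw [h1, h2]
    simp [psi_witt, phi_witt]
  have : (psi p r).comp (phi p) = (phi p).comp (psi p r) := by
    apply MvPolynomial.algHom_ext
    intro i
    exact congrFun key i
  exact DFunLike.congr_fun this x

lemma dvd_phi_sub (p : ℕ) [Fact p.Prime] (x : MvPolynomial ℕ ℤ) :
    (p : MvPolynomial ℕ ℤ) ∣ x ^ p - phi p x := by
  have h := MvPolynomial.C_dvd_iff_zmod p (x ^ p - phi p x)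
  rw [map_natCast] at h
  rw [h, map_sub, sub_eq_zero, map_pow]
  have e : ((frobenius (MvPolynomial ℕ (ZMod p)) p).comp (MvPolynomial.map (Int.castRingHom (ZMod p))))
      = (MvPolynomial.map (Int.castRingHom (ZMod p))).comp (phi p).toRingHom := by
    apply MvPolynomial.ringHom_ext
    · intro r
      simp only [eq_intCast, map_intCast]
    · intro i
      simp [phi, WittVector.frobeniusPoly_zmod, frobenius_def]
  exact DFunLike.congr_fun e x

lemma dvd_psi_X (p r : ℕ) [hp : Fact p.Prime] (n : ℕ) (hn : n ≤ r) :
    (p : MvPolynomial ℕ ℤ) ^ (r - n) ∣ psi p r (X n) := by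
  induction n using Nat.strong_induction_on with
  | _ n ih =>
    have h := psi_witt p r n
    rw [wittPolynomial_eq_sum_C_mul_X_pow, map_sum, Finset.sum_range_succ] at h
    simp only [map_mul, map_pow, Nat.sub_self, pow_zero, pow_one, map_natCast] at h
    have hp0 : (p : MvPolynomial ℕ ℤ) ≠ 0 := by
      exact_mod_cast hp.out.ne_zero
    have hd : (p : MvPolynomial ℕ ℤ) ^ r ∣ (p : MvPolynomial ℕ ℤ) ^ n * psi p r (X n) := by
      rw [← eq_sub_iff_add_eq'] at h
      rw [h]
      apply dvd_sub (dvd_mul_right _ _)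
      apply Finset.dvd_sum
      intro j hj
      rw [Finset.mem_range] at hj
      have h1 := pow_dvd_pow_of_dvd (ih j hj (by omega)) (p ^ (n - j))
      rw [← pow_mul] at h1
      have h2 := mul_dvd_mul_left ((p : MvPolynomial ℕ ℤ) ^ j) h1
      rw [← pow_add] at h2
      refine dvd_trans (pow_dvd_pow _ ?_) h2
      have : 1 ≤ p ^ (n - j) := Nat.one_le_pow _ _ hp.out.pos
      have : (r - j) * 1 ≤ (r - j) * p ^ (n - j) := Nat.mul_le_mul_left _ this
      omega
    have e : (p : MvPolynomial ℕ ℤ) ^ r = (p : MvPolynomial ℕ ℤ) ^ n * (p : MvPolynomial ℕ ℤ) ^ (r - n) := by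
      rw [← pow_add]; congr 1; omega
    rw [e] at hd
    exact (mul_dvd_mul_iff_left (pow_ne_zero _ hp0)).1 hd

lemma fact_val (p m : ℕ) [hp : Fact p.Prime] :
    padicValNat p (m.factorial) = m / p + padicValNat p ((m / p).factorial) := by
  conv_lhs => rw [← Nat.div_add_mod m p]
  rw [padicValNat_factorial_mul_add _ (Nat.mod_lt _ hp.out.pos), padicValNat_factorial_mul]
  ring

lemma exists_pow (p r : ℕ) [hp : Fact p.Prime] (m : ℕ) :
    ∀ (g : MvPolynomial ℕ ℤ) (c : ℕ), 1 ≤ c → (p : MvPolynomial ℕ ℤ) ^ c ∣ psi p r g →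
      ∃ G, (p : MvPolynomial ℕ ℤ) ∣ G - g ^ m ∧
        (p : MvPolynomial ℕ ℤ) ^ (c * m + padicValNat p m.factorial) ∣ psi p r G := by
  induction m using Nat.strong_induction_on with
  | _ m ih =>
    intro g c hc hg
    rcases Nat.eq_zero_or_pos m with rfl | hm
    · exact ⟨1, by simp, by simp⟩
    have hp1 := hp.out.two_le
    obtain ⟨f, hf⟩ := hg
    have hpc : (p - 1) * c + c = p * c := by
      obtain ⟨q, rfl⟩ : ∃ q, p = q + 1 := ⟨p - 1, by omega⟩
      simp; ring
    obtain ⟨G, hG1, hG2⟩ := ih (m / p) (Nat.div_lt_self hm hp1)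
      (g ^ p - (p : MvPolynomial ℕ ℤ) ^ ((p - 1) * c) * phi p g) (p * c + 1) (by omega) (by
        rw [map_sub, map_mul, map_pow, map_pow, map_natCast, psi_phi, hf, map_mul, map_pow,
          map_natCast, ← mul_assoc, ← pow_add, hpc, mul_pow, ← pow_mul, mul_comm c p, ← mul_sub,
          pow_succ]
        exact mul_dvd_mul_left _ (dvd_phi_sub p f))
    refine ⟨g ^ (m % p) * G, ?_, ?_⟩
    · have h1 : (p : MvPolynomial ℕ ℤ) ∣
          (g ^ p - (p : MvPolynomial ℕ ℤ) ^ ((p - 1) * c) * phi p g) - g ^ p := by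
        have : (p : MvPolynomial ℕ ℤ) ∣ (p : MvPolynomial ℕ ℤ) ^ ((p - 1) * c) :=
          dvd_pow_self _ (Nat.mul_ne_zero (by omega) (by omega))
        rw [sub_sub_cancel_left]
        exact (Dvd.dvd.mul_right this _).neg_right
      have h2 := dvd_trans h1 (sub_dvd_pow_sub_pow _ _ (m / p))
      have h3 := dvd_add hG1 h2
      rw [sub_add_sub_cancel, ← pow_mul] at h3
      have h4 := h3.mul_left (g ^ (m % p))
      rwa [mul_sub, ← pow_add, Nat.mod_add_div] at h4
    · rw [map_mul, map_pow, hf]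
      have : c * m + padicValNat p m.factorial
          = c * (m % p) + ((p * c + 1) * (m / p) + padicValNat p (m / p).factorial) := by
        rw [fact_val]
        have h : c * (m % p + p * (m / p)) = c * m := by rw [Nat.mod_add_div]
        rw [← h]
        ring
      rw [this, pow_add, pow_mul]
      exact mul_dvd_mul (pow_dvd_pow_of_dvd (dvd_mul_right _ _) _) hG2

/-- the exponent `c_{p,r}` for a multiplicity vector -/
def cc (p r : ℕ) (s : ℕ →₀ ℕ) : ℕ :=
  ∑ i ∈ Finset.range r, ((r - i) * s i + padicValNat p (s i).factorial)

lemma exists_g (p r : ℕ) [hp : Fact p.Prime] (s : ℕ →₀ ℕ) :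
    ∃ G, (p : MvPolynomial ℕ ℤ) ∣ G - monomial s 1 ∧
        (p : MvPolynomial ℕ ℤ) ^ (cc p r s) ∣ psi p r G := by
  have h1 : ∀ i, ∃ G, (p : MvPolynomial ℕ ℤ) ∣ G - X i ^ s i ∧
      (p : MvPolynomial ℕ ℤ) ^ (if i < r then (r - i) * s i + padicValNat p (s i).factorial else 0)
        ∣ psi p r G := by
    intro i
    split_ifs with hi
    · exact exists_pow p r (s i) (X i) (r - i) (by omega) (dvd_psi_X p r i hi.le)
    · exact ⟨X i ^ s i, by simp, by simp⟩
  choose G hG1 hG2 using h1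
  have hA : ∀ t : Finset ℕ, (p : MvPolynomial ℕ ℤ) ∣ ∏ i ∈ t, G i - ∏ i ∈ t, X i ^ s i := by
    intro t
    induction t using Finset.induction_on with
    | empty => simp
    | insert a t ha ih =>
      rw [Finset.prod_insert ha, Finset.prod_insert ha]
      have e : G a * ∏ i ∈ t, G i - X a ^ s a * ∏ i ∈ t, X i ^ s i
          = G a * (∏ i ∈ t, G i - ∏ i ∈ t, X i ^ s i)
            + (G a - X a ^ s a) * ∏ i ∈ t, (X i : MvPolynomial ℕ ℤ) ^ s i := by ring
      rw [e]
      exact dvd_add (ih.mul_left _) ((hG1 a).mul_right _)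
  refine ⟨∏ i ∈ s.support ∪ Finset.range r, G i, ?_, ?_⟩
  · have e : (monomial s 1 : MvPolynomial ℕ ℤ) = ∏ i ∈ s.support ∪ Finset.range r, X i ^ s i := by
      rw [monomial_eq, C_1, one_mul, Finsupp.prod]
      apply Finset.prod_subset Finset.subset_union_left
      intro i _ hi
      rw [Finsupp.notMem_support_iff.1 hi, pow_zero]
    rw [e]
    exact hA _
  · have e : cc p r s = ∑ i ∈ s.support ∪ Finset.range r,
        (if i < r then (r - i) * s i + padicValNat p (s i).factorial else 0) := by
      unfold cc
      rw [← Finset.sum_filter]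
      apply Finset.sum_congr
      · ext i
        simp only [Finset.mem_filter, Finset.mem_union, Finset.mem_range]
        tauto
      · intros; rfl
    rw [e, map_prod, ← Finset.prod_pow_eq_pow_sum]
    exact Finset.prod_dvd_prod_of_dvd _ _ fun i _ => hG2 i

end YED

/-! ### Part 2: homogeneity -/

namespace YED

open MvPolynomial

/-- the weight of a multiplicity vector -/
def wt (p : ℕ) (s : ℕ →₀ ℕ) : ℕ := Finsupp.weight (fun i => p ^ i) s

lemma hom_of_witt (p : ℕ) [hp : Fact p.Prime] {σ : Type*} (W : σ → ℕ) (y : ℕ → MvPolynomial σ ℤ)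
    (h : ∀ n, IsWeightedHomogeneous W (aeval y (wittPolynomial p ℤ n)) (p ^ n)) (n : ℕ) :
    IsWeightedHomogeneous W (y n) (p ^ n) := by
  induction n using Nat.strong_induction_on with
  | _ n ih =>
    have h1 := h n
    rw [aeval_wittPolynomial, Finset.sum_range_succ] at h1
    have h2 : IsWeightedHomogeneous W (∑ x ∈ Finset.range n,
        (p : MvPolynomial σ ℤ) ^ x * y x ^ p ^ (n - x)) (p ^ n) := by
      apply IsWeightedHomogeneous.sum
      intro j hj
      rw [Finset.mem_range] at hj
      have h3 := (ih j hj).pow (p ^ (n - j))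
      have e : p ^ (n - j) • p ^ j = p ^ n := by
        rw [smul_eq_mul, ← pow_add]; congr 1; omega
      rw [e] at h3
      have h4 := h3.C_mul ((p : ℤ) ^ j)
      rwa [map_pow, map_natCast] at h4
    have h5 := h1.sub h2
    rw [add_sub_cancel_left, Nat.sub_self, pow_zero, pow_one] at h5
    intro d hd
    apply h5
    have e : (p : MvPolynomial σ ℤ) ^ n = C ((p : ℤ) ^ n) := by simp
    rw [e, coeff_C_mul]
    exact mul_ne_zero (pow_ne_zero _ (by exact_mod_cast hp.out.ne_zero)) hd

lemma hom_monomial (p : ℕ) {σ : Type*} (W : σ → ℕ) (y : ℕ → MvPolynomial σ ℤ)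
    (hy : ∀ n, IsWeightedHomogeneous W (y n) (p ^ n)) (s : ℕ →₀ ℕ) :
    IsWeightedHomogeneous W (aeval y (monomial s (1 : ℤ))) (wt p s) := by
  rw [aeval_monomial, map_one, one_mul, Finsupp.prod]
  have := IsWeightedHomogeneous.prod s.support (fun i => y i ^ s i) (fun i => s i • p ^ i) (w := W)
    (fun i _ => (hy i).pow (s i))
  simpa [wt, Finsupp.weight_apply, Finsupp.sum] using this

lemma coeff_map_eq (p w : ℕ) {σ : Type*} (W : σ → ℕ) (y : ℕ → MvPolynomial σ ℤ)
    (hy : ∀ n, IsWeightedHomogeneous W (y n) (p ^ n))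
    {I : Type*} [Fintype I] (e : I → ℕ →₀ ℕ) (he : Function.Injective e)
    (hw : ∀ s, wt p s = w ↔ ∃ i, e i = s)
    (k : σ →₀ ℕ) (hk : Finsupp.weight W k = w) (x : MvPolynomial ℕ ℤ) :
    coeff k (aeval y x) = ∑ i, coeff k (aeval y (monomial (e i) (1 : ℤ))) * coeff (e i) x := by
  induction x using MvPolynomial.induction_on' with
  | monomial s a =>
    have e1 : (monomial s a : MvPolynomial ℕ ℤ) = a • monomial s 1 := by
      rw [smul_monomial, smul_eq_mul, mul_one]
    have e2 : coeff k (aeval y (monomial s a)) = coeff k (aeval y (monomial s (1 : ℤ))) * a := by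
      rw [e1, map_smul, coeff_smul, smul_eq_mul, mul_comm]
    rw [e2]
    simp only [coeff_monomial]
    by_cases hs : wt p s = w
    · obtain ⟨i, rfl⟩ := (hw s).1 hs
      rw [Finset.sum_eq_single i]
      · simp
      · intro j _ hj
        rw [if_neg, mul_zero]
        exact fun h => hj (he h.symm)
      · simp
    · rw [(hom_monomial p W y hy s).coeff_eq_zero k (by rw [hk]; exact fun h => hs h.symm), zero_mul]
      symm
      apply Finset.sum_eq_zero
      intro i _
      rw [if_neg, mul_zero]
      rintro rfl
      exact hs ((hw _).2 ⟨i, rfl⟩)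
  | add x y hx hy =>
    rw [map_add, coeff_add, hx, hy, ← Finset.sum_add_distrib]
    apply Finset.sum_congr rfl
    intro i _
    rw [coeff_add, mul_add]

lemma witt_hom (p n : ℕ) :
    IsWeightedHomogeneous (fun i => p ^ i) (wittPolynomial p ℤ n) (p ^ n) := by
  rw [wittPolynomial_eq_sum_C_mul_X_pow]
  apply IsWeightedHomogeneous.sum
  intro j hj
  rw [Finset.mem_range] at hj
  have h3 := (isWeightedHomogeneous_X ℤ (fun i => p ^ i) j).pow (p ^ (n - j))
  have e : p ^ (n - j) • p ^ j = p ^ n := by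
    rw [smul_eq_mul, ← pow_add]; congr 1; omega
  rw [e] at h3
  exact h3.C_mul _

lemma psi_hom (p r : ℕ) [Fact p.Prime] (n : ℕ) :
    IsWeightedHomogeneous (fun i => p ^ i) (WittVector.wittMulN p (p ^ r) n) (p ^ n) := by
  apply hom_of_witt
  intro n
  have h := psi_witt p r n
  unfold psi bind₁ at h
  rw [h]
  have := (witt_hom p n).C_mul ((p : ℤ) ^ r)
  rwa [map_pow, map_natCast] at this

/-- The Witt vector `∑ [xᵢ]` -/
def tW (p l : ℕ) [Fact p.Prime] : WittVector p (MvPolynomial (Fin l) ℤ) :=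
  ∑ i, WittVector.teichmuller p (X i)

lemma tW_witt (p l n : ℕ) [Fact p.Prime] :
    aeval (tW p l).coeff (wittPolynomial p ℤ n) = ∑ i : Fin l, (X i : MvPolynomial (Fin l) ℤ) ^ p ^ n := by
  have h := WittVector.ghostComponent_apply (p := p) n (tW p l)
  rw [aeval_wittPolynomial] at h ⊢
  rw [← h, tW, map_sum]
  simp only [WittVector.ghostComponent_teichmuller]

lemma tW_hom (p l n : ℕ) [Fact p.Prime] :
    IsWeightedHomogeneous (fun _ => 1) ((tW p l).coeff n) (p ^ n) := by
  apply hom_of_witt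
  intro n
  rw [tW_witt]
  apply IsWeightedHomogeneous.sum
  intro i _
  have := (isWeightedHomogeneous_X ℤ (fun _ : Fin l => 1) i).pow (p ^ n)
  simpa using this

end YED

/-! ### Part 3: combinatorics -/

namespace YED

/-- multiplicity vector -/
def ee (p w : ℕ) [hp : Fact p.Prime] (lam : PowP p w) : ℕ →₀ ℕ :=
  Finsupp.onFinset (Finset.range (w + 1)) (fun i => lam.1.parts.count (p ^ i)) (by
    intro i hi
    rw [Multiset.count_ne_zero] at hi
    have h1 : p ^ i ≤ w := by
      have := Multiset.le_sum_of_mem hi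
      rwa [lam.1.parts_sum] at this
    have h2 : i < p ^ i := Nat.lt_pow_self hp.out.one_lt
    rw [Finset.mem_range]
    omega)

variable (p w : ℕ) [hp : Fact p.Prime]

lemma ee_apply (lam : PowP p w) (i : ℕ) : ee p w lam i = lam.1.parts.count (p ^ i) := rfl

lemma pow_inj : Function.Injective (fun i => p ^ i) := Nat.pow_right_injective hp.out.two_le

lemma toFinset_eq (lam : PowP p w) :
    lam.1.parts.toFinset = (ee p w lam).support.image (fun i => p ^ i) := by
  ext j
  simp only [Multiset.mem_toFinset, Finset.mem_image, Finsupp.mem_support_iff, ee_apply,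
    Multiset.count_ne_zero]
  constructor
  · intro hj
    obtain ⟨n, rfl⟩ := lam.2 j hj
    exact ⟨n, hj, rfl⟩
  · rintro ⟨n, hn, rfl⟩
    exact hn

lemma sum_parts {M : Type*} [AddCommMonoid M] (f : ℕ → M) (lam : PowP p w) :
    (lam.1.parts.map f).sum = (ee p w lam).sum fun i m => m • f (p ^ i) := by
  rw [Finset.sum_multiset_map_count, toFinset_eq, Finset.sum_image (fun a _ b _ h => pow_inj p h)]
  rfl

lemma prod_parts {M : Type*} [CommMonoid M] (f : ℕ → M) (lam : PowP p w) :
    (lam.1.parts.map f).prod = (ee p w lam).prod fun i m => f (p ^ i) ^ m := by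
  rw [Finset.prod_multiset_map_count, toFinset_eq, Finset.prod_image (fun a _ b _ h => pow_inj p h)]
  rfl

lemma ee_inj : Function.Injective (ee p w) := by
  intro a b h
  apply Subtype.ext
  apply Nat.Partition.ext
  ext j
  by_cases hj : ∃ n, j = p ^ n
  · obtain ⟨n, rfl⟩ := hj
    exact DFunLike.congr_fun h n
  · rw [Multiset.count_eq_zero_of_notMem (fun h => hj (a.2 j h)),
      Multiset.count_eq_zero_of_notMem (fun h => hj (b.2 j h))]

lemma ee_wt (lam : PowP p w) : wt p (ee p w lam) = w := by
  have h := sum_parts p w id lam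
  rw [Multiset.map_id, lam.1.parts_sum] at h
  rw [wt, Finsupp.weight_apply]
  exact h.symm

lemma ee_surj (s : ℕ →₀ ℕ) : wt p s = w ↔ ∃ i, ee p w i = s := by
  constructor
  · intro h
    have hmem : ∀ j ∈ ∑ i ∈ s.support, Multiset.replicate (s i) (p ^ i), ∃ n, j = p ^ n := by
      intro j hj
      rw [Multiset.mem_sum] at hj
      obtain ⟨i, _, hi⟩ := hj
      exact ⟨i, Multiset.eq_of_mem_replicate hi⟩
    refine ⟨⟨⟨∑ i ∈ s.support, Multiset.replicate (s i) (p ^ i), ?_, ?_⟩, hmem⟩, ?_⟩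
    · intro j hj
      obtain ⟨n, rfl⟩ := hmem j hj
      exact Nat.pow_pos hp.out.pos
    · rw [Multiset.sum_sum]
      rw [wt, Finsupp.weight_apply, Finsupp.sum] at h
      simpa using h
    · ext j
      rw [ee_apply]
      simp only [Multiset.count_sum', Multiset.count_replicate]
      rw [Finset.sum_eq_single j]
      · simp
      · intro i _ hi
        rw [if_neg (fun h => hi (pow_inj p h))]
      · intro hj
        simpa using hj
  · rintro ⟨i, rfl⟩
    exact ee_wt p w i

lemma ee_le (lam : PowP p w) (i : ℕ) : ee p w lam i ≤ w := by
  rw [ee_apply]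
  have h1 := Multiset.count_le_card (p ^ i) lam.1.parts
  have h2 : Multiset.card lam.1.parts ≤ lam.1.parts.sum := by
    have := Multiset.card_nsmul_le_sum (s := lam.1.parts) (a := 1) (fun x hx => lam.1.parts_pos hx)
    simpa using this
  rw [lam.1.parts_sum] at h2
  omega

lemma ee_zero (lam : PowP p w) (i : ℕ) (hi : w < i) : ee p w lam i = 0 := by
  by_contra h
  have := Finsupp.support_onFinset_subset (Finsupp.mem_support_iff.2 h)
  rw [Finset.mem_range] at this
  omega

lemma ee_support (lam : PowP p w) : (ee p w lam).support ⊆ Finset.range (w + 1) :=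
  Finsupp.support_onFinset_subset

lemma card_parts (lam : PowP p w) :
    Multiset.card lam.1.parts = ∑ i ∈ Finset.range (w + 1), ee p w lam i := by
  have h := sum_parts p w (fun _ => 1) lam
  simp only [Multiset.map_const', Multiset.sum_replicate, smul_eq_mul, mul_one] at h
  rw [h, Finsupp.sum]
  apply Finset.sum_subset (ee_support p w lam)
  intro i _ hi
  exact Finsupp.notMem_support_iff.1 hi

lemma cpr_eq (r : ℕ) (lam : PowP p w) : cpr p r lam.1.parts = cc p r (ee p w lam) := by
  unfold cpr cc dval
  rw [toFinset_eq, Finset.filter_image, Finset.sum_image (fun a _ b _ h => pow_inj p h)]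
  simp only [padicValNat.prime_pow]
  apply Finset.sum_subset_zero_on_sdiff
  · intro i hi
    simp only [Finset.mem_filter] at hi
    exact Finset.mem_range.2 hi.2
  · intro i hi
    simp only [Finset.mem_sdiff, Finset.mem_filter, Finset.mem_range, Finsupp.mem_support_iff] at hi
    have : ee p w lam i = 0 := by
      by_contra h
      exact hi.2 ⟨h, hi.1⟩
    simp [this]
  · intro i _
    rfl

lemma card_le_aux (i q j q' t : ℕ) (h : q * p ^ i = q' * p ^ j) :
    (Finset.univ.filter fun lam : PowP p w => t * q ≤ ee p w lam i).card
      ≤ (Finset.univ.filter fun lam : PowP p w => t * q' ≤ ee p w lam j).card := by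
  have ex : ∀ lam : PowP p w, ∃ mu : PowP p w, t * q ≤ ee p w lam i →
      ee p w mu + Finsupp.single i (t * q) = ee p w lam + Finsupp.single j (t * q') := by
    intro lam
    by_cases hl : t * q ≤ ee p w lam i
    · have hle : Finsupp.single i (t * q) ≤ ee p w lam := by
        rw [Finsupp.single_le_iff]; exact hl
      obtain ⟨u, hu⟩ := exists_add_of_le hle
      have hw : wt p (u + Finsupp.single j (t * q')) = w := by
        have h1 := ee_wt p w lam
        rw [hu] at h1
        unfold wt at h1 ⊢
        rw [map_add, Finsupp.weight_single] at h1 ⊢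
        simp only [smul_eq_mul] at h1 ⊢
        rw [mul_assoc, h, ← mul_assoc] at h1
        omega
      obtain ⟨mu, hmu⟩ := (ee_surj p w _).1 hw
      refine ⟨mu, fun _ => ?_⟩
      rw [hmu, hu]
      abel
    · exact ⟨lam, fun h => absurd h hl⟩
  choose F hF using ex
  apply Finset.card_le_card_of_injOn F
  · intro lam hl
    simp only [Finset.coe_filter, Finset.mem_univ, true_and, Set.mem_ofPred_eq] at hl ⊢
    have h1 := DFunLike.congr_fun (hF lam hl) j
    simp only [Finsupp.add_apply, Finsupp.single_eq_same] at h1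
    rcases eq_or_ne i j with rfl | hij
    · have : q = q' := Nat.eq_of_mul_eq_mul_right (Nat.pow_pos hp.out.pos) h
      subst this
      simp only [Finsupp.single_eq_same] at h1
      omega
    · rw [Finsupp.single_apply, if_neg hij] at h1
      omega
  · intro a ha b hb hab
    simp only [Finset.coe_filter, Finset.mem_univ, true_and, Set.mem_ofPred_eq] at ha hb
    have h1 := hF a ha
    have h2 := hF b hb
    rw [hab, h2] at h1
    exact ee_inj p w (add_right_cancel h1.symm)

lemma sum_div (i q : ℕ) (hq : 0 < q) : ∑ lam : PowP p w, ee p w lam i / q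
    = ∑ t ∈ Finset.Icc 1 w, (Finset.univ.filter fun lam : PowP p w => t * q ≤ ee p w lam i).card := by
  simp only [Finset.card_filter]
  rw [Finset.sum_comm]
  apply Finset.sum_congr rfl
  intro lam _
  rw [← Finset.card_filter]
  have : (Finset.Icc 1 w).filter (fun t => t * q ≤ ee p w lam i) = Finset.Icc 1 (ee p w lam i / q) := by
    ext t
    simp only [Finset.mem_filter, Finset.mem_Icc, Nat.le_div_iff_mul_le hq]
    constructor
    · tauto
    · rintro ⟨h1, h2⟩
      refine ⟨⟨h1, ?_⟩, h2⟩
      have := ee_le p w lam i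
      nlinarith
  rw [this]
  simp

lemma sum_div_eq (i k : ℕ) :
    ∑ lam : PowP p w, ee p w lam i / p ^ k = ∑ lam : PowP p w, ee p w lam (i + k) := by
  have h := sum_div p w (i + k) 1 one_pos
  simp only [Nat.div_one] at h
  rw [h, sum_div p w i (p ^ k) (Nat.pow_pos hp.out.pos)]
  apply Finset.sum_congr rfl
  intro t _
  have e : p ^ k * p ^ i = 1 * p ^ (i + k) := by rw [one_mul, pow_add, mul_comm]
  exact le_antisymm (card_le_aux p w _ _ _ _ _ e) (card_le_aux p w _ _ _ _ _ e.symm)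

lemma sum_val (i : ℕ) : ∑ lam : PowP p w, padicValNat p (ee p w lam i).factorial
    = ∑ k ∈ Finset.range w, ∑ lam : PowP p w, ee p w lam (i + 1 + k) := by
  have h : ∀ lam : PowP p w, padicValNat p (ee p w lam i).factorial
      = ∑ k ∈ Finset.Ico 1 (w + 1), ee p w lam i / p ^ k := by
    intro lam
    apply padicValNat_factorial
    have h1 := Nat.log_le_self p (ee p w lam i)
    have h2 := ee_le p w lam i
    omega
  simp only [h]
  rw [Finset.sum_comm, Finset.sum_Ico_eq_sum_range]
  apply Finset.sum_congr rfl
  intro k _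
  rw [sum_div_eq, add_assoc]

lemma sum_cc (r : ℕ) : ∑ lam : PowP p w, cc p r (ee p w lam)
    = ∑ lam : PowP p w, r * Multiset.card lam.1.parts := by
  simp only [card_parts]
  rw [← Finset.mul_sum, Finset.sum_comm]
  unfold cc
  rw [Finset.sum_comm]
  simp only [Finset.sum_add_distrib, ← Finset.mul_sum]
  simp only [sum_val]
  generalize hM : (fun i => ∑ lam : PowP p w, ee p w lam i) = M
  have hM' : ∀ i, ∑ lam : PowP p w, ee p w lam i = M i := fun i => congrFun hM i
  have hM0 : ∀ i, w < i → M i = 0 := by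
    intro i hi
    rw [← hM']
    exact Finset.sum_eq_zero fun lam _ => ee_zero p w lam i hi
  simp only [hM']
  induction r with
  | zero => simp
  | succ r ih =>
    rw [Finset.sum_range_succ, Finset.sum_range_succ _ r]
    have e1 : ∑ x ∈ Finset.range r, (r + 1 - x) * M x
        = ∑ x ∈ Finset.range r, (r - x) * M x + ∑ x ∈ Finset.range r, M x := by
      rw [← Finset.sum_add_distrib]
      apply Finset.sum_congr rfl
      intro x hx
      rw [Finset.mem_range] at hx
      rw [Nat.succ_sub hx.le, Nat.succ_mul]
    have e2 : ∑ x ∈ Finset.range (w + 1), M x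
        = ∑ x ∈ Finset.range r, M x + M r + ∑ k ∈ Finset.range w, M (r + 1 + k) := by
      rw [← Finset.sum_range_succ, ← Finset.sum_range_add]
      apply Finset.sum_subset
      · intro x
        simp only [Finset.mem_range]
        omega
      · intro x _ hx
        simp only [Finset.mem_range] at hx
        exact hM0 x (by omega)
    rw [e1, Nat.succ_mul]
    have e3 : r + 1 - r = 1 := by omega
    rw [e3, one_mul]
    linarith

lemma sum_fact : ∑ lam : PowP p w, ∑ i ∈ Finset.range (w + 1), padicValNat p (ee p w lam i).factorial
    = ∑ lam : PowP p w, ∑ i ∈ Finset.range (w + 1), i * ee p w lam i := by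
  have h := sum_cc p w (w + 1)
  simp only [card_parts] at h
  unfold cc at h
  have : ∀ lam : PowP p w, (w + 1) * ∑ i ∈ Finset.range (w + 1), ee p w lam i
      = ∑ i ∈ Finset.range (w + 1), (w + 1 - i) * ee p w lam i
        + ∑ i ∈ Finset.range (w + 1), i * ee p w lam i := by
    intro lam
    rw [← Finset.sum_add_distrib, Finset.mul_sum]
    apply Finset.sum_congr rfl
    intro i hi
    rw [Finset.mem_range] at hi
    rw [← Nat.add_mul]
    congr 1
    omega
  simp only [this, Finset.sum_add_distrib] at h ⊢
  omega

end YED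

/-! ### Part 4: triangular matrices -/

namespace YED

open MvPolynomial

lemma det_tri {I : Type*} [Fintype I] [inst : DecidableEq I] (len : I → ℕ) (M : Matrix I I ℤ)
    (h : ∀ i j, i ≠ j → len j ≤ len i → M i j = 0) : M.det = ∏ i, M i i := by
  have hinj : Function.Injective
      (fun i => toLex (len i, Fintype.equivFin I i) : I → ℕ ×ₗ Fin (Fintype.card I)) := by
    intro a b hab
    have := congrArg (fun x => (ofLex x).2) hab
    exact (Fintype.equivFin I).injective this
  let : LinearOrder I := LinearOrder.lift' _ hinj
  refine @Matrix.det_of_isUpperTriangular I ℤ M _ inst _ _ ?_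
  intro i j hij
  apply h i j (ne_of_gt hij)
  have h1 : (toLex (len j, Fintype.equivFin I j) : ℕ ×ₗ Fin (Fintype.card I))
      < toLex (len i, Fintype.equivFin I i) := hij
  rw [Prod.Lex.toLex_lt_toLex] at h1
  rcases h1 with h1 | h1
  · exact h1.le
  · exact h1.1.le

/-- order at least `k` -/
def Ord (k : ℕ) (x : MvPolynomial ℕ ℤ) : Prop := ∀ d : ℕ →₀ ℕ, d.degree < k → coeff d x = 0

lemma Ord.add {k : ℕ} {x y : MvPolynomial ℕ ℤ} (hx : Ord k x) (hy : Ord k y) : Ord k (x + y) := by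
  intro d hd
  rw [coeff_add, hx d hd, hy d hd, add_zero]

lemma Ord.mul {k l : ℕ} {x y : MvPolynomial ℕ ℤ} (hx : Ord k x) (hy : Ord l y) :
    Ord (k + l) (x * y) := by
  intro d hd
  rw [coeff_mul]
  apply Finset.sum_eq_zero
  rintro ⟨a, b⟩ hab
  rw [Finset.HasAntidiagonal.mem_antidiagonal] at hab
  simp only at hab ⊢
  have h1 : a.degree + b.degree = d.degree := by rw [← hab, map_add]
  by_cases h2 : a.degree < k
  · rw [hx a h2, zero_mul]
  · rw [hy b (by omega), mul_zero]

lemma Ord.mono {k l : ℕ} {x : MvPolynomial ℕ ℤ} (hx : Ord k x) (h : l ≤ k) : Ord l x :=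
  fun d hd => hx d (by omega)

lemma ord_monomial (s : ℕ →₀ ℕ) (c : ℤ) : Ord s.degree (monomial s c) := by
  intro d hd
  rw [coeff_monomial, if_neg]
  rintro rfl
  omega

/-- lowest term -/
def Lead (s : ℕ →₀ ℕ) (c : ℤ) (f : MvPolynomial ℕ ℤ) : Prop :=
  ∃ x, Ord (s.degree + 1) x ∧ f = monomial s c + x

lemma Lead.mul {s t : ℕ →₀ ℕ} {c d : ℤ} {f g : MvPolynomial ℕ ℤ} (hf : Lead s c f)
    (hg : Lead t d g) : Lead (s + t) (c * d) (f * g) := by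
  obtain ⟨x, hx, rfl⟩ := hf
  obtain ⟨y, hy, rfl⟩ := hg
  refine ⟨monomial s c * y + x * monomial t d + x * y, ?_, ?_⟩
  · rw [map_add]
    refine Ord.add (Ord.add ?_ ?_) ?_
    · exact ((ord_monomial s c).mul hy).mono (by omega)
    · exact (hx.mul (ord_monomial t d)).mono (by omega)
    · exact (hx.mul hy).mono (by omega)
  · have : (monomial (s + t) (c * d) : MvPolynomial ℕ ℤ) = monomial s c * monomial t d := by
      rw [monomial_mul]
    rw [this]
    ring

lemma lead_one : Lead 0 1 1 := ⟨0, fun d _ => by simp, by simp⟩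

lemma Lead.pow {s : ℕ →₀ ℕ} {c : ℤ} {f : MvPolynomial ℕ ℤ} (hf : Lead s c f) (n : ℕ) :
    Lead (n • s) (c ^ n) (f ^ n) := by
  induction n with
  | zero => simpa using lead_one
  | succ n ih =>
    rw [succ_nsmul, pow_succ, pow_succ]
    exact ih.mul hf

lemma lead_prod {ι : Type*} (S : Finset ι) (s : ι → ℕ →₀ ℕ) (c : ι → ℤ)
    (f : ι → MvPolynomial ℕ ℤ) (h : ∀ i ∈ S, Lead (s i) (c i) (f i)) :
    Lead (∑ i ∈ S, s i) (∏ i ∈ S, c i) (∏ i ∈ S, f i) := by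
  induction S using Finset.induction_on with
  | empty => simpa using lead_one
  | insert a S ha ih =>
    rw [Finset.sum_insert ha, Finset.prod_insert ha, Finset.prod_insert ha]
    exact (h a (Finset.mem_insert_self _ _)).mul
      (ih fun i hi => h i (Finset.mem_insert_of_mem hi))

variable (p w : ℕ) [hp : Fact p.Prime]

lemma lead_witt (n : ℕ) : Lead (Finsupp.single n 1) ((p : ℤ) ^ n) (wittPolynomial p ℤ n) := by
  refine ⟨∑ i ∈ Finset.range n, C ((p : ℤ) ^ i) * X i ^ p ^ (n - i), ?_, ?_⟩
  · intro d hd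
    rw [coeff_sum]
    apply Finset.sum_eq_zero
    intro i hi
    rw [Finset.mem_range] at hi
    rw [coeff_C_mul, coeff_X_pow, if_neg, mul_zero]
    rintro rfl
    rw [Finsupp.degree_single, Finsupp.degree_single] at hd
    have h1 : 1 < p ^ (n - i) := Nat.one_lt_pow (by omega) hp.out.one_lt
    omega
  · rw [wittPolynomial_eq_sum_C_mul_X_pow, Finset.sum_range_succ, add_comm, Nat.sub_self,
      pow_zero, pow_one, C_mul_X_eq_monomial]

/-- products of ghost components -/
def wm (s : ℕ →₀ ℕ) : MvPolynomial ℕ ℤ := s.prod fun i m => wittPolynomial p ℤ i ^ m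

lemma lead_wm (s : ℕ →₀ ℕ) : Lead s (∏ i ∈ s.support, ((p : ℤ) ^ i) ^ s i) (wm p s) := by
  have h := lead_prod s.support (fun i => s i • Finsupp.single i 1) (fun i => ((p : ℤ) ^ i) ^ s i)
    (fun i => wittPolynomial p ℤ i ^ s i) (fun i _ => (lead_witt p i).pow (s i))
  have e : ∑ i ∈ s.support, s i • Finsupp.single i 1 = s := by
    conv_rhs => rw [← Finsupp.sum_single s]
    rw [Finsupp.sum]
    apply Finset.sum_congr rfl
    intro i _
    rw [Finsupp.smul_single, smul_eq_mul, mul_one]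
  simp only [e] at h
  exact h

/-- the matrix of ghost monomials -/
def Wm : Matrix (PowP p w) (PowP p w) ℤ :=
  Matrix.of fun k m => coeff (ee p w k) (wm p (ee p w m))

lemma det_Wm : (Wm p w).det
    = (p : ℤ) ^ ∑ lam : PowP p w, ∑ i ∈ Finset.range (w + 1), i * ee p w lam i := by
  rw [← Matrix.det_transpose, det_tri (fun k => (ee p w k).degree)]
  · rw [← Finset.prod_pow_eq_pow_sum]
    apply Finset.prod_congr rfl
    intro lam _
    obtain ⟨x, hx, h⟩ := lead_wm p (ee p w lam)
    rw [Matrix.transpose_apply, Wm, Matrix.of_apply, h, coeff_add, hx _ (by omega), add_zero,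
      coeff_monomial, if_pos rfl, ← Finset.prod_pow_eq_pow_sum]
    simp only [← pow_mul]
    apply Finset.prod_subset (ee_support p w lam)
    intro i _ hi
    rw [Finsupp.notMem_support_iff.1 hi, mul_zero, pow_zero]
  · intro i j hij hle
    obtain ⟨x, hx, h⟩ := lead_wm p (ee p w i)
    rw [Matrix.transpose_apply, Wm, Matrix.of_apply, h, coeff_add, hx _ (by omega), add_zero,
      coeff_monomial, if_neg]
    exact fun h => hij (ee_inj p w h)

lemma card_fib {m l : ℕ} (a : Fin m → ℕ) (k : Fin l →₀ ℕ) :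
    coeff k (∏ j : Fin m, ∑ i : Fin l, (X i : MvPolynomial (Fin l) ℤ) ^ a j)
      = (Fintype.card {f : Fin m → Fin l //
          ∀ i, ∑ j ∈ Finset.univ.filter (fun j => f j = i), a j = k i} : ℤ) := by
  rw [Finset.prod_univ_sum, coeff_sum, Fintype.card_subtype, Finset.card_filter]
  push_cast
  rw [Fintype.piFinset_univ]
  apply Finset.sum_congr rfl
  intro f _
  have e : ∏ j, (X (f j) : MvPolynomial (Fin l) ℤ) ^ a j
      = monomial (∑ j, Finsupp.single (f j) (a j)) 1 := by
    rw [monomial_sum_one]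
    apply Finset.prod_congr rfl
    intro j _
    rw [X_pow_eq_monomial]
  rw [e, coeff_monomial]
  congr 1
  rw [Finsupp.ext_iff]
  apply propext
  apply forall_congr'
  intro i
  rw [Finsupp.finsetSum_apply, Finset.sum_filter]
  simp only [Finsupp.single_apply]

/-- indexed parts -/
def gt (mu : Multiset ℕ) (j : Fin (Multiset.card mu)) : ℕ := (mu.sort (· ≤ ·)).getD j 0

lemma map_gt (mu : Multiset ℕ) :
    (Finset.univ : Finset (Fin (Multiset.card mu))).val.map (gt mu) = mu := by
  have key : ∀ (L : List ℕ) (n : ℕ), L.length = n →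
      (Finset.univ : Finset (Fin n)).val.map (fun j : Fin n => L.getD j 0) = (L : Multiset ℕ) := by
    rintro L n rfl
    rw [Fin.univ_val_map]
    congr 1
    apply List.ext_getElem
    · simp
    · intro i h1 h2
      simp
  have := key (mu.sort (· ≤ ·)) (Multiset.card mu) (Multiset.length_sort _)
  rw [Multiset.sort_eq] at this
  exact this

lemma prod_gt {M : Type*} [CommMonoid M] (mu : Multiset ℕ) (h : ℕ → M) :
    ∏ j, h (gt mu j) = (mu.map h).prod := by
  conv_rhs => rw [← map_gt mu]
  rw [Multiset.map_map]
  rfl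

lemma sum_gt (mu : Multiset ℕ) : ∑ j, gt mu j = mu.sum := by
  conv_rhs => rw [← map_gt mu]
  rfl

lemma gt_mem (mu : Multiset ℕ) (j) : gt mu j ∈ mu := by
  have h := Multiset.mem_map_of_mem (gt mu) (Finset.mem_univ_val j)
  rwa [map_gt] at h

/-- exponent of the monomial `x ^ λ` -/
def kk (lam : Multiset ℕ) : Fin (Multiset.card lam) →₀ ℕ := Finsupp.equivFunOnFinite.symm (gt lam)

lemma Mcount_eq (lam mu : PowP p w) :
    (Mcount lam.1.parts mu.1.parts : ℤ) = coeff (kk lam.1.parts)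
      (aeval (tW p (Multiset.card lam.1.parts)).coeff (wm p (ee p w mu))) := by
  have e : aeval (tW p (Multiset.card lam.1.parts)).coeff (wm p (ee p w mu))
      = ∏ j, ∑ i, (X i : MvPolynomial (Fin (Multiset.card lam.1.parts)) ℤ) ^ gt mu.1.parts j := by
    rw [prod_gt mu.1.parts (fun a => ∑ i, (X i : MvPolynomial (Fin (Multiset.card lam.1.parts)) ℤ) ^ a),
      prod_parts, wm, map_finsuppProd]
    simp only [map_pow, tW_witt]
  rw [e, card_fib]
  rfl

lemma surj_of_fib {m l : ℕ} (a : Fin m → ℕ) (b : Fin l → ℕ) (hb : ∀ i, 0 < b i)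
    (f : Fin m → Fin l) (hf : ∀ i, ∑ j ∈ Finset.univ.filter (fun j => f j = i), a j = b i) :
    Function.Surjective f := by
  intro i
  by_contra h
  push Not at h
  have h1 := hf i
  rw [Finset.filter_eq_empty_iff.2 (fun j _ => h j), Finset.sum_empty] at h1
  exact absurd h1 (hb i).ne

lemma eq_of_bij {m l : ℕ} (a : Fin m → ℕ) (b : Fin l → ℕ)
    (f : Fin m → Fin l) (hbij : Function.Injective f)
    (hf : ∀ i, ∑ j ∈ Finset.univ.filter (fun j => f j = i), a j = b i) (j : Fin m) :
    b (f j) = a j := by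
  rw [← hf (f j)]
  have : Finset.univ.filter (fun j' => f j' = f j) = {j} := by
    ext j'
    simp [hbij.eq_iff]
  rw [this, Finset.sum_singleton]

lemma Mcount_tri (lam mu : Multiset ℕ) (hl : ∀ x ∈ lam, 0 < x) (hne : lam ≠ mu)
    (hcard : Multiset.card mu ≤ Multiset.card lam) : Mcount lam mu = 0 := by
  unfold Mcount
  rw [Fintype.card_eq_zero_iff]
  constructor
  rintro ⟨f, hf⟩
  have hs := surj_of_fib (gt mu) (gt lam) (fun i => hl _ (gt_mem lam i)) f hf
  have hcard' : Multiset.card mu = Multiset.card lam := by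
    apply le_antisymm hcard
    simpa using Fintype.card_le_of_surjective f hs
  have hb : Function.Bijective f := by
    rw [Fintype.bijective_iff_surjective_and_card]
    exact ⟨hs, by simpa using hcard'⟩
  have h1 := eq_of_bij (gt mu) (gt lam) f hb.injective hf
  apply hne
  rw [← map_gt lam, ← map_gt mu]
  have h2 : (Finset.univ : Finset (Fin (Multiset.card lam))).val
      = (Finset.univ : Finset (Fin (Multiset.card mu))).val.map f := by
    have := Finset.map_univ_equiv (Equiv.ofBijective f hb)
    rw [← this]
    rfl
  rw [h2, Multiset.map_map]
  apply Multiset.map_congr rfl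
  intro j _
  exact h1 j

lemma Mcount_diag (lam : Multiset ℕ) (hl : ∀ x ∈ lam, 0 < x) :
    Mcount lam lam = ∏ v ∈ lam.toFinset, (lam.count v).factorial := by
  have h1 : Mcount lam lam
      = Fintype.card {g : Equiv.Perm (Fin (Multiset.card lam)) // gt lam ∘ g = gt lam} := by
    unfold Mcount
    symm
    apply Fintype.card_of_bijective (f := fun g => ⟨g.1, by
      intro i
      have h := fun j => congrFun g.2 j
      have e : Finset.univ.filter (fun j => g.1 j = i) = {g.1.symm i} := by
        ext j
        simp [Equiv.eq_symm_apply]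
      rw [e, Finset.sum_singleton]
      have h2 := h (g.1.symm i)
      simp only [Function.comp_apply, Equiv.apply_symm_apply] at h2
      exact h2.symm⟩)
    constructor
    · intro a b hab
      apply Subtype.ext
      apply DFunLike.coe_injective
      exact congrArg Subtype.val hab
    · rintro ⟨f, hf⟩
      have hs := surj_of_fib (gt lam) (gt lam) (fun i => hl _ (gt_mem lam i)) f hf
      have hb : Function.Bijective f := ⟨Finite.injective_iff_surjective.2 hs, hs⟩
      refine ⟨⟨Equiv.ofBijective f hb, ?_⟩, ?_⟩
      · funext j
        exact eq_of_bij (gt lam) (gt lam) f hb.injective hf j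
      · rfl
  rw [h1]
  have h2 := DomMulAct.stabilizer_card' (gt lam)
  have h3 : Finset.image (gt lam) Finset.univ = lam.toFinset := by
    conv_rhs => rw [← map_gt lam]
    rfl
  have h4 : ∀ v, Fintype.card {a // gt lam a = v} = lam.count v := by
    intro v
    conv_rhs => rw [← map_gt lam]
    rw [Multiset.count_map, Fintype.card_subtype]
    simp only [eq_comm]
    rfl
  rw [h3] at h2
  simp only [h4] at h2
  rw [← h2]

/-- integer version of `N` -/
def NZ : Matrix (PowP p w) (PowP p w) ℤ :=
  Matrix.of fun lam mu => (Mcount lam.1.parts mu.1.parts : ℤ)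

lemma det_NZ : (NZ p w).det
    = ((∏ lam : PowP p w, ∏ i ∈ Finset.range (w + 1), (ee p w lam i).factorial : ℕ) : ℤ) := by
  rw [det_tri (fun lam => Multiset.card lam.1.parts)]
  · push_cast
    apply Finset.prod_congr rfl
    intro lam _
    rw [NZ, Matrix.of_apply, Mcount_diag _ (fun x hx => lam.1.parts_pos hx), toFinset_eq,
      Finset.prod_image (fun a _ b _ h => pow_inj p h)]
    push_cast
    apply Finset.prod_subset (ee_support p w lam)
    intro i _ hi
    rw [← ee_apply, Finsupp.notMem_support_iff.1 hi]
    simp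
  · intro i j hij hle
    rw [NZ, Matrix.of_apply, Mcount_tri _ _ (fun x hx => i.1.parts_pos hx) _ hle, Nat.cast_zero]
    intro h
    exact hij (Subtype.ext (Nat.Partition.ext h))

end YED

/-! ### Part 5: assembling the matrices -/

namespace YED

open MvPolynomial

variable (p w : ℕ) [hp : Fact p.Prime]

/-- coefficient functionals attached to `λ` -/
def FZ : Matrix (PowP p w) (PowP p w) ℤ :=
  Matrix.of fun lam k => coeff (kk lam.1.parts)
    (aeval (tW p (Multiset.card lam.1.parts)).coeff (monomial (ee p w k) (1 : ℤ)))

/-- matrix of `psi` -/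
def PZ (r : ℕ) : Matrix (PowP p w) (PowP p w) ℤ :=
  Matrix.of fun k m => coeff (ee p w k) (psi p r (monomial (ee p w m) (1 : ℤ)))

lemma kk_weight (lam : PowP p w) : Finsupp.weight (fun _ => 1) (kk lam.1.parts) = w := by
  rw [Finsupp.weight_apply, Finsupp.sum_fintype _ _ (by simp)]
  simp only [smul_eq_mul, mul_one]
  have h := sum_gt lam.1.parts
  rw [lam.1.parts_sum] at h
  exact h

lemma NZ_eq : NZ p w = FZ p w * Wm p w := by
  ext lam mu
  rw [Matrix.mul_apply, NZ, Matrix.of_apply, Mcount_eq,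
    coeff_map_eq p w (fun _ => 1) (tW p (Multiset.card lam.1.parts)).coeff (fun n => tW_hom p _ n) (ee p w) (ee_inj p w) (ee_surj p w) _
      (kk_weight p w lam)]
  rfl

lemma PZ_mul (r : ℕ) (k : PowP p w) (x : MvPolynomial ℕ ℤ) :
    ∑ m, PZ p w r k m * coeff (ee p w m) x = coeff (ee p w k) (psi p r x) :=
  (coeff_map_eq p w (fun i => p ^ i) _ (psi_hom p r) (ee p w) (ee_inj p w) (ee_surj p w) _
      (ee_wt p w k) x).symm

lemma psi_wm (r : ℕ) (lam : PowP p w) : psi p r (wm p (ee p w lam))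
    = C ((p : ℤ) ^ (r * Multiset.card lam.1.parts)) * wm p (ee p w lam) := by
  have h : Multiset.card lam.1.parts = ∑ i ∈ (ee p w lam).support, ee p w lam i := by
    have h := sum_parts p w (fun _ => 1) lam
    simp only [Multiset.map_const', Multiset.sum_replicate, smul_eq_mul, mul_one] at h
    exact h
  unfold wm
  rw [map_finsuppProd, h, Finsupp.prod, Finsupp.prod, Finset.mul_sum, ← Finset.prod_pow_eq_pow_sum,
    map_prod, ← Finset.prod_mul_distrib]
  apply Finset.prod_congr rfl
  intro i _
  rw [map_pow, psi_witt, mul_pow, ← pow_mul, map_pow, map_natCast]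

lemma PZ_Wm (r : ℕ) : PZ p w r * Wm p w = Wm p w *
    Matrix.diagonal (fun lam : PowP p w => (p : ℤ) ^ (r * Multiset.card lam.1.parts)) := by
  ext k m
  rw [Matrix.mul_apply, Matrix.mul_diagonal]
  have := PZ_mul p w r k (wm p (ee p w m))
  rw [psi_wm, coeff_C_mul, mul_comm] at this
  exact this

lemma padicVal_prod {ι : Type*} (s : Finset ι) (f : ι → ℕ) (hf : ∀ i ∈ s, f i ≠ 0) :
    padicValNat p (∏ i ∈ s, f i) = ∑ i ∈ s, padicValNat p (f i) := by
  induction s using Finset.induction_on with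
  | empty => simp
  | insert a s ha ih =>
    rw [Finset.prod_insert ha, Finset.sum_insert ha, padicValNat.mul (hf a (Finset.mem_insert_self a s))
      (Finset.prod_ne_zero_iff.2 fun i hi => hf i (Finset.mem_insert_of_mem hi)),
      ih fun i hi => hf i (Finset.mem_insert_of_mem hi)]

lemma det_FZ : ¬ (p : ℤ) ∣ (FZ p w).det := by
  intro hd
  have h := congrArg Matrix.det (NZ_eq p w)
  rw [Matrix.det_mul, det_NZ, det_Wm, ← sum_fact] at h
  have h1 := mul_dvd_mul_right hd
    ((p : ℤ) ^ ∑ lam : PowP p w, ∑ i ∈ Finset.range (w + 1), padicValNat p (ee p w lam i).factorial)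
  rw [← h, ← pow_succ'] at h1
  have h2 : p ^ ((∑ lam : PowP p w, ∑ i ∈ Finset.range (w + 1),
      padicValNat p (ee p w lam i).factorial) + 1) ∣
      ∏ lam : PowP p w, ∏ i ∈ Finset.range (w + 1), (ee p w lam i).factorial := by
    exact_mod_cast h1
  have hne : (∏ lam : PowP p w, ∏ i ∈ Finset.range (w + 1), (ee p w lam i).factorial) ≠ 0 :=
    Finset.prod_ne_zero_iff.2 fun _ _ => Finset.prod_ne_zero_iff.2 fun _ _ => Nat.factorial_ne_zero _
  rw [padicValNat_dvd_iff_le hne] at h2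
  have h3 : padicValNat p (∏ lam : PowP p w, ∏ i ∈ Finset.range (w + 1), (ee p w lam i).factorial)
      = ∑ lam : PowP p w, ∑ i ∈ Finset.range (w + 1), padicValNat p (ee p w lam i).factorial := by
    rw [padicVal_prod p _ _ (fun _ _ => Finset.prod_ne_zero_iff.2 fun _ _ => Nat.factorial_ne_zero _)]
    apply Finset.sum_congr rfl
    intro lam _
    rw [padicVal_prod p _ _ (fun _ _ => Nat.factorial_ne_zero _)]
  omega

lemma det_Wm_ne : (Wm p w).det ≠ 0 := by
  rw [det_Wm]
  exact pow_ne_zero _ (by exact_mod_cast hp.out.ne_zero)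

lemma exists_Gf (r : ℕ) : ∃ G f : Matrix (PowP p w) (PowP p w) ℤ,
    ¬ (p : ℤ) ∣ G.det ∧ ¬ (p : ℤ) ∣ f.det ∧
    PZ p w r * G = f * Matrix.diagonal (fun lam : PowP p w => (p : ℤ) ^ cpr p r lam.1.parts) := by
  choose g hg1 hg2 using fun lam : PowP p w => exists_g p r (ee p w lam)
  choose f hf using hg2
  have hp0 : (p : ℤ) ≠ 0 := by exact_mod_cast hp.out.ne_zero
  have eqn : PZ p w r * (Matrix.of fun k m => coeff (ee p w k) (g m))
      = (Matrix.of fun k m => coeff (ee p w k) (f m)) *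
        Matrix.diagonal (fun lam : PowP p w => (p : ℤ) ^ cpr p r lam.1.parts) := by
    ext k m
    rw [Matrix.mul_apply, Matrix.mul_diagonal]
    have := PZ_mul p w r k (g m)
    have e : (p : MvPolynomial ℕ ℤ) ^ cc p r (ee p w m) = C ((p : ℤ) ^ cc p r (ee p w m)) := by
      rw [map_pow, map_natCast]
    rw [hf, e, coeff_C_mul, mul_comm, ← cpr_eq] at this
    exact this
  have hG : ¬ (p : ℤ) ∣ (Matrix.of fun k m => coeff (ee p w k) (g m) :
      Matrix (PowP p w) (PowP p w) ℤ).det := by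
    intro h
    have h1 := (ZMod.intCast_zmod_eq_zero_iff_dvd _ p).2 h
    have h2 := RingHom.map_det (Int.castRingHom (ZMod p))
      (Matrix.of fun k m => coeff (ee p w k) (g m) : Matrix (PowP p w) (PowP p w) ℤ)
    have h3 : (Int.castRingHom (ZMod p)).mapMatrix
      (Matrix.of fun k m => coeff (ee p w k) (g m) : Matrix (PowP p w) (PowP p w) ℤ) = 1 := by
      ext k m
      obtain ⟨x, hx⟩ := hg1 m
      have e : (p : MvPolynomial ℕ ℤ) = C (p : ℤ) := by rw [map_natCast]
      rw [sub_eq_iff_eq_add, e] at hx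
      rw [RingHom.mapMatrix_apply, Matrix.map_apply, Matrix.of_apply, hx, coeff_add, coeff_C_mul,
        coeff_monomial, Matrix.one_apply]
      by_cases hkm : k = m
      · subst hkm
        simp
      · rw [if_neg (fun h => hkm (ee_inj p w h).symm), if_neg hkm]
        simp
    rw [h3, Matrix.det_one] at h2
    have h4 : ((Int.castRingHom (ZMod p)) (Matrix.of fun k m => coeff (ee p w k) (g m) :
      Matrix (PowP p w) (PowP p w) ℤ).det) = 0 := h1
    rw [h4] at h2
    exact zero_ne_one h2
  refine ⟨_, _, hG, ?_, eqn⟩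
  have h1 := congrArg Matrix.det (PZ_Wm p w r)
  rw [Matrix.det_mul, Matrix.det_mul, mul_comm] at h1
  have h2 := mul_left_cancel₀ (det_Wm_ne p w) h1
  have h3 := congrArg Matrix.det eqn
  rw [Matrix.det_mul, Matrix.det_mul, h2, Matrix.det_diagonal, Matrix.det_diagonal,
    Finset.prod_pow_eq_pow_sum, Finset.prod_pow_eq_pow_sum, mul_comm] at h3
  simp only [cpr_eq] at h3
  rw [sum_cc] at h3
  have h4 := mul_right_cancel₀ (pow_ne_zero _ hp0) h3
  rw [← h4]
  exact hG

lemma unit_int (hp' : p.Prime) (d : ℤ) (hd : ¬ (p : ℤ) ∣ d) :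
    IsUnit ((Int.castRingHom (Zploc p hp')) d) := by
  have h0 : (d : ℚ) ≠ 0 := by
    intro h
    apply hd
    have : d = 0 := by exact_mod_cast h
    rw [this]
    exact dvd_zero _
  have hm : (d : ℚ)⁻¹ ∈ Zploc p hp' := ⟨1, d, hd, by simp⟩
  have he : (Int.castRingHom (Zploc p hp')) d * ⟨(d : ℚ)⁻¹, hm⟩ = 1 := by
    apply Subtype.ext
    rw [Subring.coe_mul, Subring.coe_one]
    have : (((Int.castRingHom (Zploc p hp')) d : Zploc p hp') : ℚ) = d :=
      map_intCast (Zploc p hp').subtype d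
    rw [this]
    exact mul_inv_cancel₀ h0
  exact IsUnit.of_mul_eq_one _ he

lemma unit_of_not_dvd (hp' : p.Prime) (A : Matrix (PowP p w) (PowP p w) ℤ)
    (hA : ¬ (p : ℤ) ∣ A.det) :
    IsUnit (A.map (fun x => (x : Zploc p hp'))) := by
  have e : A.map (fun x => (x : Zploc p hp')) = (Int.castRingHom (Zploc p hp')).mapMatrix A := by
    ext i j
    simp
  rw [e, Matrix.isUnit_iff_isUnit_det, ← RingHom.map_det]
  exact unit_int p hp' _ hA

end YED

/-- **Theorem 4.8.** Let `N` be the `Pow(w) × Pow(w)`-matrix with `N_{λμ} = |𝓜_{λμ}|` and `b`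
the diagonal matrix with `b_λ = p^{r·l(λ)}`. The elementary divisors of `Y = N b N⁻¹` over
`ℤ_(p)` are `p^{c_{p,r}(λ)}`, `λ ∈ Pow(w)`. -/
theorem Y_elementary_divisors (p : ℕ) (hp : p.Prime) (r w : ℕ) :
    ∃ U V : Matrix (PowP p w) (PowP p w) (Zploc p hp),
      IsUnit U ∧ IsUnit V ∧
        U.map (fun x => (x : ℚ)) *
            (Nmat p w *
              Matrix.diagonal
                (fun lam : PowP p w => (p : ℚ) ^ (r * Multiset.card lam.1.parts)) *
              (Nmat p w)⁻¹) *
          V.map (fun x => (x : ℚ))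
        = Matrix.diagonal (fun lam : PowP p w => (p : ℚ) ^ cpr p r lam.1.parts) := by
  haveI : Fact p.Prime := ⟨hp⟩
  obtain ⟨G, f, hG, hf, h⟩ := YED.exists_Gf p w r
  have uF := YED.unit_of_not_dvd p w hp _ (YED.det_FZ p w)
  have uG := YED.unit_of_not_dvd p w hp _ hG
  have uf := YED.unit_of_not_dvd p w hp _ hf
  obtain ⟨F', hF1, hF2⟩ := isUnit_iff_exists.1 uF
  obtain ⟨f', hf1, hf2⟩ := isUnit_iff_exists.1 uf
  refine ⟨f' * F', (YED.FZ p w).map (fun x => (x : Zploc p hp)) * G.map (fun x => (x : Zploc p hp)),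
    ?_, uF.mul uG, ?_⟩
  · exact IsUnit.mul (isUnit_iff_exists.2 ⟨_, hf2, hf1⟩) (isUnit_iff_exists.2 ⟨_, hF2, hF1⟩)
  -- transport everything to `ℚ`
  let T : Matrix (PowP p w) (PowP p w) (Zploc p hp) →+* Matrix (PowP p w) (PowP p w) ℚ :=
    (Zploc p hp).subtype.mapMatrix
  let Q : Matrix (PowP p w) (PowP p w) ℤ →+* Matrix (PowP p w) (PowP p w) ℚ :=
    (Int.castRingHom ℚ).mapMatrix
  have hT : ∀ A : Matrix (PowP p w) (PowP p w) (Zploc p hp), A.map (fun x => (x : ℚ)) = T A :=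
    fun A => rfl
  have hTQ : ∀ A : Matrix (PowP p w) (PowP p w) ℤ, T (A.map (fun x => (x : Zploc p hp))) = Q A := by
    intro A
    ext i j
    simp [T, Q]
  have hN : Nmat p w = Q (YED.NZ p w) := by
    ext i j
    simp [Nmat, YED.NZ, Q]
  have hb : Matrix.diagonal (fun lam : PowP p w => (p : ℚ) ^ (r * Multiset.card lam.1.parts))
      = Q (Matrix.diagonal (fun lam : PowP p w => (p : ℤ) ^ (r * Multiset.card lam.1.parts))) := by
    ext i j
    by_cases hij : i = j
    · subst hij; simp [Q]
    · simp [Q, hij]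
  have hD : Matrix.diagonal (fun lam : PowP p w => (p : ℚ) ^ cpr p r lam.1.parts)
      = Q (Matrix.diagonal (fun lam : PowP p w => (p : ℤ) ^ cpr p r lam.1.parts)) := by
    ext i j
    by_cases hij : i = j
    · subst hij; simp [Q]
    · simp [Q, hij]
  rw [hT, hT, map_mul, map_mul, hTQ, hTQ, hb, hD]
  have hF2' : T F' * Q (YED.FZ p w) = 1 := by rw [← hTQ, ← map_mul, hF2, map_one]
  have hf2' : T f' * Q f = 1 := by rw [← hTQ, ← map_mul, hf2, map_one]
  have hNdet : IsUnit (Nmat p w).det := by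
    rw [hN]
    have e : (Q (YED.NZ p w)).det = (((YED.NZ p w).det : ℤ) : ℚ) :=
      (RingHom.map_det (Int.castRingHom ℚ) _).symm
    rw [e, isUnit_iff_ne_zero, YED.NZ_eq, Matrix.det_mul]
    have h1 : (YED.FZ p w).det ≠ 0 := fun h0 => YED.det_FZ p w (h0 ▸ dvd_zero _)
    exact_mod_cast mul_ne_zero h1 (YED.det_Wm_ne p w)
  have hNN : Nmat p w * (Nmat p w)⁻¹ = 1 := Matrix.mul_nonsing_inv _ hNdet
  have hNF : Nmat p w = Q (YED.FZ p w) * Q (YED.Wm p w) := by rw [hN, YED.NZ_eq, map_mul]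
  have hWF : Q (YED.Wm p w) * (Nmat p w)⁻¹ * Q (YED.FZ p w) = 1 := by
    rw [mul_eq_one_comm, ← mul_assoc, ← hNF, hNN]
  have hPW := congrArg Q (YED.PZ_Wm p w r)
  rw [map_mul, map_mul] at hPW
  have hPG := congrArg Q h
  rw [map_mul, map_mul] at hPG
  generalize Q (Matrix.diagonal (fun lam : PowP p w => (p : ℤ) ^ (r * Multiset.card lam.1.parts)))
    = B at *
  generalize Q (Matrix.diagonal (fun lam : PowP p w => (p : ℤ) ^ cpr p r lam.1.parts)) = D at *
  generalize (Nmat p w)⁻¹ = N' at *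
  rw [hNF]
  calc T f' * T F' * (Q (YED.FZ p w) * Q (YED.Wm p w) * B * N') * (Q (YED.FZ p w) * Q G)
      = T f' * (T F' * Q (YED.FZ p w)) * (Q (YED.Wm p w) * B) * N' * Q (YED.FZ p w) * Q G := by
        simp only [mul_assoc]
    _ = T f' * Q (YED.PZ p w r) * (Q (YED.Wm p w) * N' * Q (YED.FZ p w)) * Q G := by
        rw [hF2', ← hPW, mul_one]
        simp only [mul_assoc]
    _ = T f' * (Q (YED.PZ p w r) * Q G) := by rw [hWF, mul_one, mul_assoc]
    _ = D := by rw [hPG, ← mul_assoc, hf2', one_mul]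

end
end
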